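/- Let G be a finite simple graph on n vertices with no K_{2,3} minor and let ℓ ≥ 5 be an integer. Then any two proper ℓ-colorings of G are joined by a path of length at most 1387·n in the ℓ-reconfiguration graph R_ℓ(G); in particular, R_ℓ(G) is connected and has diameter at most 1387·n. -/

import Mathlib

open SimpleGraph

/-- A proper coloring of `G` with `ℓ` colors: adjacent vertices get distinct colors. -/
def IsProperColoring {V : Type} (G : SimpleGraph V) {ℓ : ℕ} (c : V → Fin ℓ) : Prop :=
  ∀ ⦃u v : V⦄, G.Adj u v → c u ≠ c v

/-- `c` is a transformation sequence from `α` to `β`: a sequence of proper colorings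
starting at `α`, ending at `β`, in which consecutive colorings differ on exactly one vertex. -/
def IsTransformSeq {V : Type} (G : SimpleGraph V) {ℓ m : ℕ}
    (c : Fin (m + 1) → V → Fin ℓ) (α β : V → Fin ℓ) : Prop :=
  c 0 = α ∧ c (Fin.last m) = β ∧ (∀ i, IsProperColoring G (c i)) ∧
    ∀ i : Fin m, ∃! v : V, c i.castSucc v ≠ c i.succ v

/-- The number of steps of the sequence `c` at which the vertex `v` is recolored. -/
def RecolorCount {V : Type} {ℓ m : ℕ} (c : Fin (m + 1) → V → Fin ℓ) (v : V) : ℕ :=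
  (Finset.univ.filter fun i : Fin m => c i.castSucc v ≠ c i.succ v).card

/-- `H` is a minor of `G`: there are pairwise disjoint nonempty branch sets in `G`, each
inducing a connected subgraph, with an edge of `G` between the branch sets of any two
vertices adjacent in `H`. -/
def IsMinor {W V : Type} (H : SimpleGraph W) (G : SimpleGraph V) : Prop :=
  ∃ B : W → Set V,
    (∀ h, (B h).Nonempty) ∧
    (Pairwise fun h h' => Disjoint (B h) (B h')) ∧
    (∀ h, (G.induce (B h)).Connected) ∧
    ∀ ⦃h h'⦄, H.Adj h h' → ∃ u ∈ B h, ∃ v ∈ B h', G.Adj u v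

/-- The colors taken by `x` along a list of recoloring events. -/
def own {κ : Type} [DecidableEq κ] (x : κ) (L : List (κ × ℕ)) : List ℕ :=
  L.filterMap fun e => if e.1 = x then some e.2 else none

/-- The events of a list which concern `u` (marked `false`) or `w` (marked `true`). -/
def pr {κ : Type} [DecidableEq κ] (u w : κ) (L : List (κ × ℕ)) : List (Bool × ℕ) :=
  L.filterMap fun e => if e.1 = u then some (false, e.2) else
    if e.1 = w then some (true, e.2) else none

/-- Two tokens starting at `a` and `b` are always at distinct colors, and every event moves. -/
def pairOK : ℕ → ℕ → List (Bool × ℕ) → Bool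
  | a, b, [] => a != b
  | a, b, (false, q) :: E => a != b && (q != a && pairOK q b E)
  | a, b, (true, q) :: E => a != b && (q != b && pairOK a q E)

/-- The pair timelines which obstruct extension to a common neighbour. -/
def bad (a b : ℕ) : List (Bool × ℕ) → Bool
  | [e, f, g, h] => decide [a, b, e.2, f.2, g.2].Nodup &&
      h.2 != (if g.1 then (own true [e, f]).getLastD b else (own false [e, f]).getLastD a)
  | _ => false

/-- At most `R` events with colors below `5`, ending at a color below `t`. -/
def vt (R t a : ℕ) (E : List ℕ) : Bool :=
  decide (E.length ≤ R) && decide (E.getLastD a < t) && E.all fun q => decide (q < 5)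

/-- Every event moves the token. -/
def nt : ℕ → List ℕ → Bool
  | _, [] => true
  | a, q :: E => q != a && nt q E

/-- The pair timelines maintained along edges to which a vertex may be attached. -/
def fl (R t a b : ℕ) (E : List (Bool × ℕ)) : Bool :=
  pairOK a b E && vt R t a (own false E) && vt R t b (own true E) && !bad a b E

/-- Depth-first search: insert moves of the tokens in `mv` into the list `E`. -/
def insertSearch (C R : ℕ) (mv : List ℕ) (P : List (ℕ × ℕ) → Bool) :
    ℕ → List ℕ → List (ℕ × ℕ) → List (ℕ × ℕ) → Option (List (ℕ × ℕ))
  | 0, _, _, acc => if P acc.reverse then some acc.reverse else none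
  | n + 1, pos, E, acc =>
      (match E with
      | [] => if P acc.reverse then some acc.reverse else none
      | (s, q) :: E' => if pos.elem q then none else
          insertSearch C R mv P n (pos.set s q) E' ((s, q) :: acc)).or
      (mv.findSome? fun i => if R ≤ (own i acc).length then none else
        (List.range C).findSome? fun d => if pos.elem d then none else
          insertSearch C R mv P n (pos.set i d) E ((i, d) :: acc))

def searchOK (C R : ℕ) (mv : List ℕ) (P : List (ℕ × ℕ) → Bool)
    (pos : List ℕ) (E : List (ℕ × ℕ)) : Bool :=
  match insertSearch C R mv P (E.length + R * mv.length) pos E [] with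
  | some T => P T
  | none => false

/-- All proper pair timelines of length at most `n` with colors below `5` satisfy `p`. -/
def allPairs : ℕ → ℕ → ℕ → (List (Bool × ℕ) → Bool) → Bool
  | 0, _, _, p => p []
  | n + 1, a, b, p => p [] && (List.range 5).all fun q => q == a || q == b ||
      (allPairs n q b (fun l => p ((false, q) :: l)) &&
        allPairs n a q (fun l => p ((true, q) :: l)))

/-- All lists of length at most `n` with entries below `C` satisfy `p`. -/
def allLists (C : ℕ) : ℕ → (List ℕ → Bool) → Bool
  | 0, p => p []
  | n + 1, p => p [] && (List.range C).all fun q => allLists C n fun l => p (q :: l)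

/-- Normal form of the `i`-th color of a list, depending on whether the color is large. -/
def nf (t i : ℕ) (large : Bool) : ℕ := bif large then (bif t == 4 then 4 else 5 + i) else i

/-- `T` extends the pair timeline `E` of the tokens `0`, `1` by a common neighbour `2`. -/
def extendsPair (R t a b c : ℕ) (E T : List (ℕ × ℕ)) : Bool :=
  (T.all fun e => decide (e.1 < 3)) && ((T.filter fun e => e.1 != 2) == E) &&
    fl R t a c (pr 0 2 T) && fl R t b c (pr 1 2 T)

def checkPair (R t : ℕ) (x y z : Bool) : Bool :=
  t == 4 && ((x && y) || (x && z) || (y && z)) ||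
  allPairs (2 * R) (nf t 0 x) (nf t 1 y) fun E => !fl R t (nf t 0 x) (nf t 1 y) E ||
    searchOK 5 R [2] (extendsPair R t (nf t 0 x) (nf t 1 y) (nf t 2 z)
        (E.map fun e => (bif e.1 then 1 else 0, e.2)))
      [nf t 0 x, nf t 1 y, nf t 2 z] (E.map fun e => (bif e.1 then 1 else 0, e.2))

/-- `T` extends the timeline `E` of the token `0` by a neighbour `1`. -/
def extendsOne (R t a c : ℕ) (E : List ℕ) (T : List (ℕ × ℕ)) : Bool :=
  (T.all fun e => decide (e.1 < 2)) && (own 0 T == E) && fl R t a c (pr 0 1 T)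

def checkOne (R t : ℕ) (x z : Bool) : Bool :=
  t == 4 && (x && z) ||
  allLists 5 R fun E => !vt R t (nf t 0 x) E || !nt (nf t 0 x) E ||
    searchOK 5 R [1] (extendsOne R t (nf t 0 x) (nf t 1 z) E) [nf t 0 x, nf t 1 z]
      (E.map fun q => (0, q))

/-- `T` extends the timeline `E` of the token `0` to a clique. -/
def extendsClique (R t : ℕ) (pos : List ℕ) (E : List ℕ) (T : List (ℕ × ℕ)) : Bool :=
  (T.all fun e => decide (e.1 < pos.length)) && (own 0 T == E) &&
  (List.range pos.length).all fun i =>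
    vt R t (pos.getD i 0) (own i T) && nt (pos.getD i 0) (own i T) &&
      (List.range i).all fun j => pairOK (pos.getD j 0) (pos.getD i 0) (pr j i T)

def checkClique (R t : ℕ) (l : List Bool) : Bool :=
  t == 4 && decide (1 < l.count true) ||
  allLists 5 R fun E => !vt R t ((l.mapIdx (nf t)).getD 0 0) E ||
    !nt ((l.mapIdx (nf t)).getD 0 0) E ||
      searchOK 5 R (List.range l.length).tail (extendsClique R t (l.mapIdx (nf t)) E)
        (l.mapIdx (nf t)) (E.map fun q => (0, q))

/-- `T` extends the timeline `E` of the token `0` to a clique, with prescribed final colors. -/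
def extendsTo (pos tgt : List ℕ) (E : List ℕ) (T : List (ℕ × ℕ)) : Bool :=
  (T.all fun e => decide (e.1 < pos.length)) && (own 0 T == E) &&
  (T.all fun e => decide (e.2 < 4)) &&
  (List.range pos.length).all fun i =>
    (own i T).getLastD (pos.getD i 0) == tgt.getD i 0 && decide ((own i T).length ≤ 3) &&
    nt (pos.getD i 0) (own i T) &&
      (List.range i).all fun j => pairOK (pos.getD j 0) (pos.getD i 0) (pr j i T)

def checkTriangle : Bool :=
  allLists 4 3 fun E => !nt 0 E || (List.range 4).all fun b => (List.range 4).all fun c =>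
    E.getLastD 0 == b || E.getLastD 0 == c || b == c ||
      searchOK 4 3 [1, 2] (extendsTo [0, 1, 2] [E.getLastD 0, b, c] E) [0, 1, 2]
        (E.map fun q => (0, q))

/-! ### Projections -/

section Projections
variable {κ κ' : Type} [DecidableEq κ] [DecidableEq κ']

@[simp] lemma own_nil (x : κ) : own x ([] : List (κ × ℕ)) = [] := rfl

@[simp] lemma pr_nil (u w : κ) : pr u w ([] : List (κ × ℕ)) = [] := rfl

lemma own_cons (x : κ) (e : κ × ℕ) (L : List (κ × ℕ)) :
    own x (e :: L) = if e.1 = x then e.2 :: own x L else own x L := by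
  by_cases h : e.1 = x <;> simp [own, h]

lemma pr_cons (u w : κ) (e : κ × ℕ) (L : List (κ × ℕ)) :
    pr u w (e :: L) = if e.1 = u then (false, e.2) :: pr u w L else
      if e.1 = w then (true, e.2) :: pr u w L else pr u w L := by
  by_cases h : e.1 = u
  · simp [pr, h]
  · by_cases h' : e.1 = w
    · rw [if_neg h, if_pos h']
      exact List.filterMap_cons_some (by simp only [if_neg h, if_pos h'])
    · simp [pr, h, h']

lemma own_append (x : κ) (L L' : List (κ × ℕ)) : own x (L ++ L') = own x L ++ own x L' := by
  simp [own]

lemma pr_append (u w : κ) (L L' : List (κ × ℕ)) : pr u w (L ++ L') = pr u w L ++ pr u w L' := by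
  simp [pr]

lemma own_map {j : κ → κ'} {σ : ℕ → ℕ} {x : κ} {T : List (κ × ℕ)}
    (h : ∀ e ∈ T, j e.1 = j x → e.1 = x) :
    own (j x) (T.map (Prod.map j σ)) = (own x T).map σ := by
  induction T with
  | nil => rfl
  | cons e T ih =>
    have h1 := h e (by simp)
    have h2 := ih fun e he => h e (by simp [he])
    by_cases hx : e.1 = x
    · simp [own_cons, hx, h2]
    · have : j e.1 ≠ j x := fun h => hx (h1 h)
      simp [own_cons, hx, h2, this]

lemma pr_map {j : κ → κ'} {σ : ℕ → ℕ} {u w : κ} {T : List (κ × ℕ)}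
    (hu : ∀ e ∈ T, j e.1 = j u → e.1 = u) (hw : ∀ e ∈ T, j e.1 = j w → e.1 = w) :
    pr (j u) (j w) (T.map (Prod.map j σ)) = (pr u w T).map (Prod.map id σ) := by
  induction T with
  | nil => rfl
  | cons e T ih =>
    have h1 := hu e (by simp)
    have h1' := hw e (by simp)
    have h2 := ih (fun e he => hu e (by simp [he])) (fun e he => hw e (by simp [he]))
    by_cases hx : e.1 = u
    · simp [pr_cons, hx, h2]
    · have : j e.1 ≠ j u := fun h => hx (h1 h)
      by_cases hy : e.1 = w
      · have hwu : j w ≠ j u := by rw [← hy]; exact this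
        have hwu' : w ≠ u := fun h => hwu (by rw [h])
        simp [pr_cons, hy, h2, hwu, hwu']
      · have h3 : j e.1 ≠ j w := fun h => hy (h1' h)
        simp only [List.map_cons, pr_cons, Prod.map_fst, if_neg hx, if_neg hy, if_neg this,
          if_neg h3, h2]

lemma own_filter {x : κ} {p : κ → Bool} (hx : p x = true) (L : List (κ × ℕ)) :
    own x (L.filter fun e => p e.1) = own x L := by
  induction L with
  | nil => rfl
  | cons e L ih =>
    by_cases h : e.1 = x
    · simp [h, hx, own_cons, ih]
    · by_cases h' : p e.1 <;> simp [h, h', own_cons, ih]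

lemma pr_filter {u w : κ} {p : κ → Bool} (hu : p u = true) (hw : p w = true)
    (L : List (κ × ℕ)) : pr u w (L.filter fun e => p e.1) = pr u w L := by
  induction L with
  | nil => rfl
  | cons e L ih =>
    by_cases h : e.1 = u
    · simp [h, hu, pr_cons, ih]
    · by_cases h2 : e.1 = w
      · simp [h2, hw, pr_cons, ih]
      · by_cases h' : p e.1 <;> simp [h, h2, h', pr_cons, ih]

lemma own_false_pr {u w : κ} (L : List (κ × ℕ)) : own false (pr u w L) = own u L := by
  induction L with
  | nil => rfl
  | cons e L ih =>
    rw [pr_cons, own_cons]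
    split_ifs <;> simp [own_cons, ih]

lemma own_true_pr {u w : κ} (huw : u ≠ w) (L : List (κ × ℕ)) :
    own true (pr u w L) = own w L := by
  induction L with
  | nil => rfl
  | cons e L ih =>
    rw [pr_cons, own_cons]
    by_cases h : e.1 = u
    · simp [h, huw, own_cons, ih]
    · by_cases h2 : e.1 = w
      · simp [h2, huw.symm, own_cons, ih]
      · simp [h, h2, ih]

/-- Exchange the roles of the two tokens of a pair timeline. -/
def flipPair (E : List (Bool × ℕ)) : List (Bool × ℕ) := E.map (Prod.map (!·) id)

lemma pr_swap {u w : κ} (huw : u ≠ w) (L : List (κ × ℕ)) : pr w u L = flipPair (pr u w L) := by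
  induction L with
  | nil => rfl
  | cons e L ih =>
    by_cases h : e.1 = u
    · simp [h, huw, flipPair, pr_cons, ih]
    · by_cases h2 : e.1 = w
      · simp [h2, huw.symm, flipPair, pr_cons, ih]
      · simp [h, h2, pr_cons, ih]

lemma filter_eq_own (x : κ) (L : List (κ × ℕ)) :
    (L.filter fun e => decide (e.1 = x)) = (own x L).map fun q => (x, q) := by
  induction L with
  | nil => rfl
  | cons e L ih =>
    rw [own_cons]
    by_cases h : e.1 = x
    · subst h; simp [ih]
    · simp [h, ih]

lemma filter_eq_pr {u w : κ} (L : List (κ × ℕ)) :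
    (L.filter fun e => decide (e.1 = u ∨ e.1 = w)) =
      (pr u w L).map fun e => (bif e.1 then w else u, e.2) := by
  simp only [Bool.decide_or]
  induction L with
  | nil => rfl
  | cons e L ih =>
    rw [pr_cons]
    by_cases h : e.1 = u
    · subst h; simp [ih]
    · by_cases h2 : e.1 = w
      · subst h2; simp [h, ih]
      · simp [h, h2, ih]

end Projections

lemma pr_false_true (E : List (Bool × ℕ)) : pr false true E = E := by
  induction E with
  | nil => rfl
  | cons e E ih => obtain ⟨_ | _, q⟩ := e <;> simp [pr_cons, ih]

lemma flipPair_cons (e : Bool × ℕ) (E : List (Bool × ℕ)) :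
    flipPair (e :: E) = (!e.1, e.2) :: flipPair E := rfl

lemma own_flipPair (x : Bool) (E : List (Bool × ℕ)) : own x (flipPair E) = own (!x) E := by
  induction E with
  | nil => rfl
  | cons e E ih => obtain ⟨_ | _, q⟩ := e <;> cases x <;> simp [flipPair_cons, own_cons, ih]

lemma pairOK_flip (a b : ℕ) (E : List (Bool × ℕ)) : pairOK b a (flipPair E) = pairOK a b E := by
  induction E generalizing a b with
  | nil => simp [flipPair, pairOK, bne_comm]
  | cons e E ih => obtain ⟨_ | _, q⟩ := e <;> simp [flipPair_cons, pairOK, ih, bne_comm (a := a)]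

lemma bad_flip (a b : ℕ) (E : List (Bool × ℕ)) : bad b a (flipPair E) = bad a b E := by
  match E with
  | [] => rfl
  | [_] => rfl
  | [_, _] => rfl
  | [_, _, _] => rfl
  | [e, f, g, h] =>
    have h1 : [b, a, e.2, f.2, g.2].Nodup ↔ [a, b, e.2, f.2, g.2].Nodup :=
      (List.Perm.swap _ _ _).nodup_iff
    have h2 := own_flipPair true [e, f]
    have h3 := own_flipPair false [e, f]
    simp only [flipPair, List.map_cons, List.map_nil, Bool.not_true, Bool.not_false] at h2 h3
    simp only [bad, flipPair, List.map_cons, List.map_nil, h2, h3, Prod.map_fst, Prod.map_snd, id]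
    simp only [h1]
    cases g.1 <;> simp
  | _ :: _ :: _ :: _ :: _ :: _ => rfl

lemma fl_flip (R t a b : ℕ) (E : List (Bool × ℕ)) : fl R t b a (flipPair E) = fl R t a b E := by
  simp only [fl, pairOK_flip, bad_flip, own_flipPair, Bool.not_true, Bool.not_false]
  rw [Bool.and_assoc, Bool.and_assoc, Bool.and_assoc, Bool.and_assoc]
  congr 1
  rw [← Bool.and_assoc, ← Bool.and_assoc]
  congr 1
  rw [Bool.and_comm]

lemma fl_pairOK {R t a b : ℕ} {E : List (Bool × ℕ)} (h : fl R t a b E) : pairOK a b E := by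
  simp only [fl, Bool.and_eq_true] at h; exact h.1.1.1

lemma fl_left {R t a b : ℕ} {E : List (Bool × ℕ)} (h : fl R t a b E) : vt R t a (own false E) := by
  simp only [fl, Bool.and_eq_true] at h; exact h.1.1.2

lemma fl_right {R t a b : ℕ} {E : List (Bool × ℕ)} (h : fl R t a b E) : vt R t b (own true E) := by
  simp only [fl, Bool.and_eq_true] at h; exact h.1.2

lemma pairOK_ne {a b : ℕ} {E : List (Bool × ℕ)} (h : pairOK a b E) : a ≠ b := by
  match E with
  | [] => simpa [pairOK] using h
  | (false, q) :: E => simp [pairOK] at h; exact h.1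
  | (true, q) :: E => simp [pairOK] at h; exact h.1

/-! ### Renaming colors -/

lemma bne_map (σ : Equiv.Perm ℕ) (a b : ℕ) : (σ a != σ b) = (a != b) := by
  rw [Bool.eq_iff_iff]; simp

lemma pairOK_map (σ : Equiv.Perm ℕ) (a b : ℕ) (E : List (Bool × ℕ)) :
    pairOK (σ a) (σ b) (E.map (Prod.map id σ)) = pairOK a b E := by
  induction E generalizing a b with
  | nil => simp [pairOK, bne_map]
  | cons e E ih => obtain ⟨_ | _, q⟩ := e <;> simp [pairOK, ih, bne_map]

lemma own_map_color {κ : Type} [DecidableEq κ] (σ : ℕ → ℕ) (x : κ) (T : List (κ × ℕ)) :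
    own x (T.map (Prod.map id σ)) = (own x T).map σ :=
  own_map (j := id) fun _ _ h => h

lemma bad_map (σ : Equiv.Perm ℕ) (a b : ℕ) (E : List (Bool × ℕ)) :
    bad (σ a) (σ b) (E.map (Prod.map id σ)) = bad a b E := by
  match E with
  | [] => rfl
  | [_] => rfl
  | [_, _] => rfl
  | [_, _, _] => rfl
  | [e, f, g, h] =>
    have h1 : [σ a, σ b, σ e.2, σ f.2, σ g.2].Nodup ↔ [a, b, e.2, f.2, g.2].Nodup :=
      List.nodup_map_iff (l := [a, b, e.2, f.2, g.2]) σ.injective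
    have h2 := fun x => own_map_color σ x [e, f]
    simp only [List.map_cons, List.map_nil] at h2
    have h3 : ∀ (l : List ℕ) c, (l.map σ).getLastD (σ c) = σ (l.getLastD c) := by
      intro l c
      simp [List.getLastD_eq_getLast?]
    simp only [bad, List.map_cons, List.map_nil, h2, h3, Prod.map_fst, Prod.map_snd, id]
    simp only [h1]
    cases g.1 <;> simp [bne_map]
  | _ :: _ :: _ :: _ :: _ :: _ => rfl

/-- A permutation of the colors respecting the two thresholds. -/
def Respects (t : ℕ) (σ : Equiv.Perm ℕ) : Prop :=
  ∀ c, (σ c < 5 ↔ c < 5) ∧ (σ c < t ↔ c < t)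

lemma vt_map {t : ℕ} {σ : Equiv.Perm ℕ} (hσ : Respects t σ) (R a : ℕ) (E : List ℕ) :
    vt R t (σ a) (E.map σ) = vt R t a E := by
  have h3 : (E.map σ).getLastD (σ a) = σ (E.getLastD a) := by
    simp [List.getLastD_eq_getLast?]
  simp only [vt, h3, (hσ _).2, List.length_map, List.all_map, Function.comp_def, (hσ _).1]

lemma fl_map {t : ℕ} {σ : Equiv.Perm ℕ} (hσ : Respects t σ) (R a b : ℕ) (E : List (Bool × ℕ)) :
    fl R t (σ a) (σ b) (E.map (Prod.map id σ)) = fl R t a b E := by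
  simp only [fl, pairOK_map, own_map_color, vt_map hσ, bad_map]

lemma nt_map (σ : Equiv.Perm ℕ) (a : ℕ) (E : List ℕ) : nt (σ a) (E.map σ) = nt a E := by
  induction E generalizing a with
  | nil => rfl
  | cons q E ih => simp [nt, ih, bne_map]

lemma nt_left {a b : ℕ} {E : List (Bool × ℕ)} (h : pairOK a b E) : nt a (own false E) := by
  induction E generalizing a b with
  | nil => rfl
  | cons e E ih =>
    obtain ⟨_ | _, q⟩ := e <;> simp only [pairOK, Bool.and_eq_true] at h
    · simp [own_cons, nt, ih h.2.2, h.2.1]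
    · simp [own_cons, ih h.2.2]

lemma nt_right {a b : ℕ} {E : List (Bool × ℕ)} (h : pairOK a b E) : nt b (own true E) := by
  rw [← pairOK_flip] at h
  simpa [own_flipPair] using nt_left h

lemma Respects.symm {t : ℕ} {σ : Equiv.Perm ℕ} (hσ : Respects t σ) : Respects t σ.symm := by
  intro c
  have := hσ (σ.symm c)
  simpa [iff_comm] using this

lemma exists_respects (t : ℕ) (l l' : List ℕ) (hl : l.Nodup) (hl' : l'.Nodup)
    (h : List.Forall₂ (fun c c' => (c' < 5 ↔ c < 5) ∧ (c' < t ↔ c < t)) l' l) :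
    ∃ σ, Respects t σ ∧ l = l'.map σ := by
  induction h with
  | nil => exact ⟨1, fun c => by simp, rfl⟩
  | @cons x' x xs' xs hx hxs ih =>
    obtain ⟨σ, hσ, rfl⟩ := ih hl.of_cons hl'.of_cons
    refine ⟨σ.trans (Equiv.swap (σ x') x), fun c => ?_, ?_⟩
    · have h1 := hσ c
      have h2 := hσ x'
      simp only [Equiv.trans_apply, Equiv.swap_apply_def]
      split_ifs with h3 h4
      · have := σ.injective h3; subst this; constructor <;> omega
      · rw [h4] at h1; constructor <;> omega
      · exact h1
    · simp only [List.map_cons, Equiv.trans_apply, Equiv.swap_apply_left, List.cons.injEq, true_and]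
      refine List.map_congr_left fun c hc => ?_
      simp only [Equiv.trans_apply]
      rw [Equiv.swap_apply_of_ne_of_ne]
      · exact fun h => hl'.notMem (σ.injective h ▸ hc)
      · exact fun h => hl.notMem (h ▸ List.mem_map_of_mem hc)

lemma nodup_nf (t : ℕ) (ht : t = 4 ∨ t = 5) (l : List Bool) (hl : l.length ≤ 4)
    (hc : t = 4 → l.count true ≤ 1) : (l.mapIdx (nf t)).Nodup := by
  rcases l with _ | ⟨a, _ | ⟨b, _ | ⟨c, _ | ⟨d, _ | ⟨e, l⟩⟩⟩⟩⟩
  · simp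
  · simp
  · rcases ht with rfl | rfl <;> revert a b <;> decide
  · rcases ht with rfl | rfl <;> revert a b c <;> decide
  · rcases ht with rfl | rfl <;> revert a b c d <;> decide
  · simp at hl; omega

/-- Normal form of a list of distinct colors. -/
lemma exists_nf (t : ℕ) (ht : t = 4 ∨ t = 5) (l : List ℕ) (hl : l.Nodup) (hlen : l.length ≤ 4)
    (hc : ∀ c ∈ l, t = 4 → c < 5) :
    ∃ bl : List Bool, bl.length = l.length ∧ (t = 4 → bl.count true ≤ 1) ∧
      ∃ σ, Respects t σ ∧ l = (bl.mapIdx (nf t)).map σ := by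
  have h1 : t = 4 → (l.map fun c => decide (t ≤ c)).count true ≤ 1 := by
    rintro rfl
    refine le_trans ?_ (List.nodup_iff_count_le_one.1 hl 4)
    rw [List.count, List.countP_map, List.count]
    refine List.countP_mono_left fun c hc' => ?_
    have := hc c hc' rfl
    simp
    omega
  refine ⟨l.map fun c => decide (t ≤ c), by simp, h1, ?_⟩
  refine exists_respects t l _ hl (nodup_nf t ht _ (by simpa) h1) ?_
  rw [List.forall₂_iff_get]
  refine ⟨by simp, fun i h1 h2 => ?_⟩
  have h3 := hc _ (List.getElem_mem h2)
  simp only [List.get_eq_getElem, List.getElem_mapIdx, List.getElem_map, nf]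
  rcases ht with rfl | rfl
  · simp at h3
    by_cases h4 : 4 ≤ l[i] <;> simp [h4] <;> omega
  · by_cases h4 : 5 ≤ l[i] <;> simp [h4] <;> omega

/-! ### Extending timelines -/

set_option maxRecDepth 100000

lemma checkTriangle_eq : checkTriangle = true := by decide +kernel

lemma checkOne_big : ∀ x z, checkOne 1 5 x z = true := by decide +kernel

lemma checkOne_four : ∀ x z, checkOne 2 4 x z = true := by decide +kernel

lemma checkPair_big : ∀ x y z, checkPair 1 5 x y z = true := by decide +kernel

lemma checkPair_four : ∀ x y z, checkPair 2 4 x y z = true := by decide +kernel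

lemma checkClique_one (x : Bool) : (checkClique 1 5 [x] && checkClique 2 4 [x]) = true := by
  revert x; decide +kernel

lemma checkClique_two (x y : Bool) :
    (checkClique 1 5 [x, y] && checkClique 2 4 [x, y]) = true := by
  revert x y; decide +kernel

lemma checkClique_three (x y z : Bool) :
    (checkClique 1 5 [x, y, z] && checkClique 2 4 [x, y, z]) = true := by
  revert x y z; decide +kernel

lemma checkClique_four (x y z w : Bool) :
    (checkClique 1 5 [x, y, z, w] && checkClique 2 4 [x, y, z, w]) = true := by
  revert x y z w; decide +kernel

lemma exists_of_searchOK {C R : ℕ} {mv : List ℕ} {P : List (ℕ × ℕ) → Bool} {pos : List ℕ}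
    {E : List (ℕ × ℕ)} (h : searchOK C R mv P pos E) : ∃ T, P T := by
  unfold searchOK at h
  split at h
  · exact ⟨_, h⟩
  · exact absurd h (by simp)

lemma of_allPairs {n a b : ℕ} {p : List (Bool × ℕ) → Bool} (h : allPairs n a b p)
    {E : List (Bool × ℕ)} (hE : pairOK a b E) (hn : E.length ≤ n) (h5 : ∀ e ∈ E, e.2 < 5) :
    p E := by
  induction n generalizing a b p E with
  | zero =>
    obtain rfl : E = [] := List.length_eq_zero_iff.1 (by omega)
    exact h
  | succ n ih =>
    simp only [allPairs, Bool.and_eq_true, List.all_eq_true, Bool.or_eq_true, beq_iff_eq] at h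
    obtain _ | ⟨⟨s, q⟩, E⟩ := E
    · exact h.1
    · have h1 := h.2 q (by simpa using h5 (s, q) (by simp))
      have h2 : E.length ≤ n := by simpa using hn
      have h3 : ∀ e ∈ E, e.2 < 5 := fun e he => h5 e (by simp [he])
      cases s <;> simp only [pairOK, Bool.and_eq_true, bne_iff_ne] at hE
      · have h4 := pairOK_ne hE.2.2
        exact ih (h1.resolve_left (by tauto)).1 hE.2.2 h2 h3
      · have h4 := pairOK_ne hE.2.2
        exact ih (h1.resolve_left (by tauto)).2 hE.2.2 h2 h3

lemma of_allLists {C n : ℕ} {p : List ℕ → Bool} (h : allLists C n p) {E : List ℕ}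
    (hn : E.length ≤ n) (hC : ∀ q ∈ E, q < C) : p E := by
  induction n generalizing p E with
  | zero =>
    obtain rfl : E = [] := List.length_eq_zero_iff.1 (by omega)
    exact h
  | succ n ih =>
    simp only [allLists, Bool.and_eq_true, List.all_eq_true] at h
    obtain _ | ⟨q, E⟩ := E
    · exact h.1
    · exact ih (h.2 q (by simpa using hC q (by simp))) (by simpa using hn)
        fun r hr => hC r (by simp [hr])

lemma length_pair (E : List (Bool × ℕ)) :
    E.length = (own false E).length + (own true E).length := by
  induction E with
  | nil => rfl
  | cons e E ih => obtain ⟨_ | _, q⟩ := e <;> simp [own_cons, ih] <;> omega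

lemma mem_own {κ : Type} [DecidableEq κ] {x : κ} {L : List (κ × ℕ)} {q : ℕ} :
    q ∈ own x L ↔ (x, q) ∈ L := by
  induction L with
  | nil => simp
  | cons e L ih =>
    rw [own_cons, List.mem_cons]
    split_ifs with h
    · subst h; simp [ih, Prod.ext_iff]
    · rw [ih]
      exact ⟨Or.inr, fun h' => h'.resolve_left fun h'' => h (by rw [← h''])⟩

lemma vt_iff {R t a : ℕ} {E : List ℕ} :
    vt R t a E ↔ E.length ≤ R ∧ E.getLastD a < t ∧ ∀ q ∈ E, q < 5 := by
  simp [vt, and_assoc]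

lemma fl_length {R t a b : ℕ} {E : List (Bool × ℕ)} (h : fl R t a b E) : E.length ≤ 2 * R := by
  have h1 := (vt_iff.1 (fl_left h)).1
  have h2 := (vt_iff.1 (fl_right h)).1
  rw [length_pair]; omega

lemma fl_lt {R t a b : ℕ} {E : List (Bool × ℕ)} (h : fl R t a b E) : ∀ e ∈ E, e.2 < 5 := by
  rintro ⟨_ | _, q⟩ he
  · exact (vt_iff.1 (fl_left h)).2.2 q (mem_own.2 he)
  · exact (vt_iff.1 (fl_right h)).2.2 q (mem_own.2 he)

/-- The parameters of the two color-reducing stages. -/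
def StageParams (R t : ℕ) : Prop := (R = 1 ∧ t = 5) ∨ (R = 2 ∧ t = 4)

lemma StageParams.ht {R t : ℕ} (h : StageParams R t) : t = 4 ∨ t = 5 := by
  rcases h with h | h <;> simp [h.2]

lemma map_id_symm {κ : Type} (σ : Equiv.Perm ℕ) (E : List (κ × ℕ)) :
    (E.map (Prod.map id σ.symm)).map (Prod.map id σ) = E := by
  simp [Function.comp_def, Prod.map]

lemma map_map_symm (σ : Equiv.Perm ℕ) (E : List ℕ) : (E.map σ.symm).map σ = E := by
  simp [Function.comp_def]

lemma exists_extend_pair {R t : ℕ} (hs : StageParams R t) {a b c : ℕ} {E : List (Bool × ℕ)}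
    (hE : fl R t a b E) (hca : c ≠ a) (hcb : c ≠ b) (hin : t = 4 → a < 5 ∧ b < 5 ∧ c < 5) :
    ∃ T : List (ℕ × ℕ), (∀ e ∈ T, e.1 = a ∨ e.1 = b ∨ e.1 = c) ∧ pr a b T = E ∧
      fl R t a c (pr a c T) ∧ fl R t b c (pr b c T) := by
  have hab := pairOK_ne (fl_pairOK hE)
  obtain ⟨bl, hlen, hcount, σ, hσ, hl⟩ := exists_nf t hs.ht [a, b, c]
    (by simp [hab, hca.symm, hcb.symm]) (by simp)
    (by intro d hd h4; have := hin h4; simp at hd; rcases hd with rfl | rfl | rfl <;> tauto)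
  match bl, hlen with
  | [x, y, z], _ =>
  simp only [List.mapIdx_cons, List.mapIdx_nil, List.map_cons, List.map_nil, List.cons.injEq,
    and_true] at hl
  obtain ⟨ha, hb, hc⟩ := hl
  simp only [Nat.zero_add] at ha hb hc
  have hE0 : fl R t (nf t 0 x) (nf t 1 y) (E.map (Prod.map id σ.symm)) := by
    rw [← fl_map hσ, map_id_symm, ← ha, ← hb]; exact hE
  have hch : checkPair R t x y z = true := by
    rcases hs with ⟨rfl, rfl⟩ | ⟨rfl, rfl⟩
    · exact checkPair_big x y z
    · exact checkPair_four x y z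
  simp only [checkPair, Bool.or_eq_true] at hch
  replace hch := hch.resolve_left (by
    intro h
    simp only [Bool.and_eq_true, beq_iff_eq, Bool.or_eq_true] at h
    have h1 := hcount h.1
    rcases h.2 with (h | h) | h <;> rw [h.1, h.2] at h1 <;> revert h1 <;> simp [List.count_cons] <;> omega)
  have h2 := of_allPairs hch (fl_pairOK hE0) (fl_length hE0) (fl_lt hE0)
  rw [Bool.or_eq_true] at h2
  obtain ⟨T, hT⟩ := exists_of_searchOK (h2.resolve_left (by simp [hE0]))
  simp only [extendsPair, Bool.and_eq_true, List.all_eq_true, decide_eq_true_eq, beq_iff_eq] at hT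
  obtain ⟨⟨⟨hlab, hfil⟩, h02⟩, h12⟩ := hT
  let j : ℕ → ℕ := fun i => [a, b, c].getD i 0
  have hj : ∀ i < 3, ∀ e ∈ T, j e.1 = j i → e.1 = i := by
    intro i hi e he
    have := hlab e he
    generalize e.1 = k at *
    interval_cases i <;> interval_cases k <;> simp [j, hab, hca, hcb, hab.symm, hca.symm, hcb.symm]
  have hpr : ∀ i < 3, ∀ k < 3, pr (j i) (j k) (T.map (Prod.map j σ)) =
      (pr i k T).map (Prod.map id σ) := fun i hi k hk => pr_map (hj i hi) (hj k hk)
  refine ⟨T.map (Prod.map j σ), ?_, ?_, ?_, ?_⟩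
  · intro e he
    obtain ⟨e', he', rfl⟩ := List.mem_map.1 he
    have := hlab e' he'
    simp only [Prod.map_fst]
    generalize e'.1 = k at *
    interval_cases k <;> simp [j]
  · refine (hpr 0 (by simp) 1 (by simp)).trans ?_
    rw [← pr_filter (u := 0) (w := 1) (p := fun i => i != 2) (by simp) (by simp), hfil]
    have := pr_map (j := fun s : Bool => bif s then 1 else 0) (σ := id) (u := false) (w := true)
      (T := E.map (Prod.map id σ.symm)) (by simp) (by simp)
    simp only [cond_true, cond_false, pr_false_true, Prod.map_id, List.map_id] at this
    rw [show (fun e : Bool × ℕ => ((bif e.1 then 1 else 0 : ℕ), e.2)) =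
      Prod.map (fun s : Bool => bif s then 1 else 0) id from rfl, this, map_id_symm]
  · have := hpr 0 (by simp) 2 (by simp)
    rw [show j 0 = a from rfl, show j 2 = c from rfl] at this
    rw [this, ha, hc, fl_map hσ]; exact h02
  · have := hpr 1 (by simp) 2 (by simp)
    rw [show j 1 = b from rfl, show j 2 = c from rfl] at this
    rw [this, hb, hc, fl_map hσ]; exact h12

lemma exists_extend_one {R t : ℕ} (hs : StageParams R t) {a c : ℕ} {E : List ℕ}
    (hE : vt R t a E) (hnt : nt a E) (hca : c ≠ a) (hin : t = 4 → a < 5 ∧ c < 5) :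
    ∃ T : List (ℕ × ℕ), (∀ e ∈ T, e.1 = a ∨ e.1 = c) ∧ own a T = E ∧ fl R t a c (pr a c T) := by
  obtain ⟨bl, hlen, hcount, σ, hσ, hl⟩ := exists_nf t hs.ht [a, c]
    (by simp [hca.symm]) (by simp)
    (by intro d hd h4; have := hin h4; simp at hd; rcases hd with rfl | rfl <;> tauto)
  match bl, hlen with
  | [x, z], _ =>
  simp only [List.mapIdx_cons, List.mapIdx_nil, List.map_cons, List.map_nil, List.cons.injEq,
    and_true] at hl
  obtain ⟨ha, hc⟩ := hl
  simp only [Nat.zero_add] at ha hc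
  have hE0 : vt R t (nf t 0 x) (E.map σ.symm) := by
    rw [← vt_map hσ, map_map_symm, ← ha]; exact hE
  have hnt0 : nt (nf t 0 x) (E.map σ.symm) := by
    rw [← nt_map σ, map_map_symm, ← ha]; exact hnt
  have hch : checkOne R t x z = true := by
    rcases hs with ⟨rfl, rfl⟩ | ⟨rfl, rfl⟩
    · exact checkOne_big x z
    · exact checkOne_four x z
  simp only [checkOne, Bool.or_eq_true] at hch
  replace hch := hch.resolve_left (by
    intro h
    simp only [Bool.and_eq_true, beq_iff_eq] at h
    have h1 := hcount h.1
    rw [h.2.1, h.2.2] at h1; revert h1; simp)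
  have h2 := of_allLists hch (vt_iff.1 hE0).1 (vt_iff.1 hE0).2.2
  rw [Bool.or_eq_true] at h2
  obtain ⟨T, hT⟩ := exists_of_searchOK (h2.resolve_left (by simp [hE0, hnt0]))
  simp only [extendsOne, Bool.and_eq_true, List.all_eq_true, decide_eq_true_eq, beq_iff_eq] at hT
  obtain ⟨⟨hlab, hown⟩, h01⟩ := hT
  let j : ℕ → ℕ := fun i => [a, c].getD i 0
  have hj : ∀ i < 2, ∀ e ∈ T, j e.1 = j i → e.1 = i := by
    intro i hi e he
    have := hlab e he
    generalize e.1 = k at *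
    interval_cases i <;> interval_cases k <;> simp [j, hca, hca.symm]
  refine ⟨T.map (Prod.map j σ), ?_, ?_, ?_⟩
  · intro e he
    obtain ⟨e', he', rfl⟩ := List.mem_map.1 he
    have := hlab e' he'
    simp only [Prod.map_fst]
    generalize e'.1 = k at *
    interval_cases k <;> simp [j]
  · refine (own_map (x := 0) (hj 0 (by simp))).trans ?_
    rw [hown, map_map_symm]
  · have := pr_map (σ := σ) (hj 0 (by simp)) (hj 1 (by simp))
    rw [show j 0 = a from rfl, show j 1 = c from rfl] at this
    rw [this, ha, hc, fl_map hσ]; exact h01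

lemma exists_extend_clique {R t : ℕ} (hs : StageParams R t) {a : ℕ} {l : List ℕ} {E : List ℕ}
    (hE : vt R t a E) (hnt : nt a E) (hl : (a :: l).Nodup) (hlen : l.length ≤ 3)
    (hin : t = 4 → ∀ c ∈ a :: l, c < 5) :
    ∃ T : List (ℕ × ℕ), (∀ e ∈ T, e.1 ∈ a :: l) ∧ own a T = E ∧
      (∀ c ∈ a :: l, vt R t c (own c T) ∧ nt c (own c T)) ∧
      ∀ c ∈ a :: l, ∀ d ∈ a :: l, c ≠ d → pairOK c d (pr c d T) := by
  obtain ⟨bl, hlen', hcount, σ, hσ, hl'⟩ := exists_nf t hs.ht (a :: l) hl (by simp; omega)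
    (fun c hc h4 => hin h4 c hc)
  have hpos : bl.length = l.length + 1 := by simpa using hlen'
  have ha : a = σ ((bl.mapIdx (nf t)).getD 0 0) := by
    have := congrArg (fun l => l.getD 0 0) hl'
    simp only [List.getD_cons_zero] at this
    rw [this, List.getD_eq_getElem _ _ (by simp; omega), List.getD_eq_getElem _ _ (by simp; omega)]
    simp
  have hE0 : vt R t ((bl.mapIdx (nf t)).getD 0 0) (E.map σ.symm) := by
    rw [← vt_map hσ, map_map_symm, ← ha]; exact hE
  have hnt0 : nt ((bl.mapIdx (nf t)).getD 0 0) (E.map σ.symm) := by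
    rw [← nt_map σ, map_map_symm, ← ha]; exact hnt
  have hch : checkClique R t bl = true := by
    have : (checkClique 1 5 bl && checkClique 2 4 bl) = true := by
      match bl, (by omega : 1 ≤ bl.length), (by omega : bl.length ≤ 4) with
      | [x], _, _ => exact checkClique_one x
      | [x, y], _, _ => exact checkClique_two x y
      | [x, y, z], _, _ => exact checkClique_three x y z
      | [x, y, z, w], _, _ => exact checkClique_four x y z w
    rw [Bool.and_eq_true] at this
    rcases hs with ⟨rfl, rfl⟩ | ⟨rfl, rfl⟩
    · exact this.1
    · exact this.2
  rw [checkClique, Bool.or_eq_true] at hch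
  replace hch := hch.resolve_left (by
    intro h
    simp only [Bool.and_eq_true, beq_iff_eq, decide_eq_true_eq] at h
    have h1 := hcount h.1
    omega)
  have h2 := of_allLists hch (vt_iff.1 hE0).1 (vt_iff.1 hE0).2.2
  rw [Bool.or_eq_true] at h2
  obtain ⟨T, hT⟩ := exists_of_searchOK (h2.resolve_left (by rw [hE0, hnt0]; simp))
  simp only [extendsClique, Bool.and_eq_true, List.all_eq_true, decide_eq_true_eq, beq_iff_eq,
    List.mem_range, List.length_mapIdx] at hT
  obtain ⟨⟨hlab, hown⟩, hall⟩ := hT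
  let j : ℕ → ℕ := fun i => (a :: l).getD i 0
  have hjσ : ∀ i < bl.length, j i = σ ((bl.mapIdx (nf t)).getD i 0) := by
    intro i hi
    have : j i = _ := congrArg (fun l => l.getD i 0) hl'
    rw [this, List.getD_eq_getElem _ _ (by simpa), List.getD_eq_getElem _ _ (by simpa)]
    simp
  have hinj : ∀ i < bl.length, ∀ k < bl.length, j i = j k → i = k := by
    intro i hi k hk h
    simp only [j] at h
    rw [List.getD_eq_getElem _ _ (by simp; omega), List.getD_eq_getElem _ _ (by simp; omega)] at h
    exact (List.Nodup.getElem_inj_iff hl).1 h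
  have hj : ∀ i < bl.length, ∀ e ∈ T, j e.1 = j i → e.1 = i :=
    fun i hi e he h => hinj _ (hlab e he) i hi h
  have hsurj : ∀ c ∈ a :: l, ∃ i < bl.length, c = j i := by
    intro c hc
    obtain ⟨i, hi, rfl⟩ := List.getElem_of_mem hc
    exact ⟨i, by omega, by simp only [j]; rw [List.getD_eq_getElem]⟩
  refine ⟨T.map (Prod.map j σ), ?_, ?_, ?_, ?_⟩
  · intro e he
    obtain ⟨e', he', rfl⟩ := List.mem_map.1 he
    have := hlab e' he'
    simp only [Prod.map_fst, j]
    rw [List.getD_eq_getElem _ _ (by simp; omega)]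
    exact List.getElem_mem _
  · refine (own_map (x := 0) (hj 0 (by omega))).trans ?_
    rw [hown, map_map_symm]
  · intro c hc
    obtain ⟨i, hi, rfl⟩ := hsurj c hc
    rw [own_map (hj i hi), hjσ i hi, vt_map hσ, nt_map]
    exact (hall i hi).1
  · intro c hc d hd hcd
    obtain ⟨i, hi, rfl⟩ := hsurj c hc
    obtain ⟨k, hk, rfl⟩ := hsurj d hd
    have hik : i ≠ k := fun h => hcd (by rw [h])
    rcases lt_or_gt_of_ne hik with h | h
    · rw [pr_map (hj i hi) (hj k hk), hjσ i hi, hjσ k hk, pairOK_map]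
      exact (hall k hk).2 i h
    · rw [pr_swap hcd.symm, pairOK_flip, pr_map (hj k hk) (hj i hi), hjσ i hi, hjσ k hk, pairOK_map]
      exact (hall i hi).2 k h

/-- A timeline with at most three moves between the colors below `4`, from `a` to `b`. -/
def Moves (a b : ℕ) (E : List ℕ) : Prop :=
  E.length ≤ 3 ∧ nt a E ∧ E.getLastD a = b ∧ ∀ q ∈ E, q < 4

lemma getLastD_map_perm (σ : Equiv.Perm ℕ) (E : List ℕ) (a : ℕ) :
    (E.map σ).getLastD (σ a) = σ (E.getLastD a) := by
  simp [List.getLastD_eq_getLast?]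

lemma Moves.map {a b : ℕ} {E : List ℕ} {σ : Equiv.Perm ℕ} (hσ : Respects 4 σ)
    (h : Moves a b E) : Moves (σ a) (σ b) (E.map σ) := by
  refine ⟨by simpa using h.1, by rw [nt_map]; exact h.2.1, ?_, ?_⟩
  · rw [getLastD_map_perm, h.2.2.1]
  · intro q hq
    obtain ⟨r, hr, rfl⟩ := List.mem_map.1 hq
    exact (hσ r).2.2 (h.2.2.2 r hr)

lemma exists_extend_triangle {a b c a' b' c' : ℕ} {E : List ℕ} (hE : Moves a a' E)
    (ha : a < 4) (hb : b < 4) (hc : c < 4) (hab : b ≠ a) (hac : c ≠ a) (hbc : b ≠ c)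
    (hb' : b' < 4) (hc' : c' < 4) (hab' : b' ≠ a') (hac' : c' ≠ a') (hbc' : b' ≠ c') :
    ∃ T : List (ℕ × ℕ), (∀ e ∈ T, e.1 = a ∨ e.1 = b ∨ e.1 = c) ∧ own a T = E ∧
      Moves b b' (own b T) ∧ Moves c c' (own c T) ∧
      pairOK a b (pr a b T) ∧ pairOK a c (pr a c T) ∧ pairOK b c (pr b c T) := by
  obtain ⟨σ, hσ, hl⟩ := exists_respects 4 [a, b, c] [0, 1, 2]
    (by simp [hab.symm, hac.symm, hbc]) (by simp) (by simp; omega)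
  simp only [List.map_cons, List.map_nil, List.cons.injEq, and_true] at hl
  obtain ⟨h0, h1, h2⟩ := hl
  have hσ' := hσ.symm
  have hE0 := hE.map hσ'
  have ha0 : σ.symm a = 0 := by rw [h0]; simp
  rw [ha0] at hE0
  have h3 := of_allLists checkTriangle_eq hE0.1 hE0.2.2.2
  simp only [Bool.or_eq_true, List.all_eq_true, List.mem_range] at h3
  have h4 := h3.resolve_left (by simp [hE0.2.1]) (σ.symm b') ((hσ' b').2.2 hb') (σ.symm c')
    ((hσ' c').2.2 hc')
  have h5 := h4.resolve_left (by
    simp only [hE0.2.2.1, beq_iff_eq, EmbeddingLike.apply_eq_iff_eq]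
    tauto)
  obtain ⟨T, hT⟩ := exists_of_searchOK h5
  simp only [extendsTo, Bool.and_eq_true, List.all_eq_true, decide_eq_true_eq, beq_iff_eq,
    List.mem_range, List.length_cons, List.length_nil] at hT
  obtain ⟨⟨⟨hlab, hown⟩, hlt⟩, hall⟩ := hT
  have hall1 := hall 1 (by simp)
  have hall2 := hall 2 (by simp)
  simp only [List.getD_cons_succ, List.getD_cons_zero] at hall1 hall2
  let j : ℕ → ℕ := fun i => [a, b, c].getD i 0
  have hj : ∀ i < 3, ∀ e ∈ T, j e.1 = j i → e.1 = i := by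
    intro i hi e he
    have := hlab e he
    generalize e.1 = k at *
    interval_cases i <;> interval_cases k <;>
      simp [j, hab, hac, hbc, hab.symm, hac.symm, hbc.symm]
  have hmv : ∀ i < 3, ∀ u v, (own i T).length ≤ 3 → nt u (own i T) → (own i T).getLastD u = v →
      Moves (σ u) (σ v) (own (j i) (T.map (Prod.map j σ))) := by
    intro i hi u v h1 h2 h3
    rw [own_map (hj i hi)]
    exact Moves.map hσ ⟨h1, h2, h3, fun q hq => hlt _ (mem_own.1 hq)⟩
  have hpr : ∀ i < 3, ∀ k < 3, pr (j i) (j k) (T.map (Prod.map j σ)) =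
      (pr i k T).map (Prod.map id σ) := fun i hi k hk => pr_map (hj i hi) (hj k hk)
  refine ⟨T.map (Prod.map j σ), ?_, ?_, ?_, ?_, ?_, ?_, ?_⟩
  · intro e he
    obtain ⟨e', he', rfl⟩ := List.mem_map.1 he
    have := hlab e' he'
    simp only [Prod.map_fst]
    generalize e'.1 = k at *
    interval_cases k <;> simp [j]
  · refine (own_map (x := 0) (hj 0 (by simp))).trans ?_
    rw [hown, map_map_symm]
  · have := hmv 1 (by simp) 1 _ hall1.1.1.2 hall1.1.2 hall1.1.1.1
    rwa [← h1, Equiv.apply_symm_apply] at this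
  · have := hmv 2 (by simp) 2 _ hall2.1.1.2 hall2.1.2 hall2.1.1.1
    rwa [← h2, Equiv.apply_symm_apply] at this
  · have := hpr 0 (by simp) 1 (by simp)
    rw [show j 0 = a from rfl, show j 1 = b from rfl] at this
    rw [this, h0, h1, pairOK_map]; exact hall1.2 0 (by simp)
  · have := hpr 0 (by simp) 2 (by simp)
    rw [show j 0 = a from rfl, show j 2 = c from rfl] at this
    rw [this, h0, h2, pairOK_map]; exact hall2.2 0 (by simp)
  · have := hpr 1 (by simp) 2 (by simp)
    rw [show j 1 = b from rfl, show j 2 = c from rfl] at this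
    rw [this, h1, h2, pairOK_map]; exact hall2.2 1 (by simp)

lemma exists_lt_four_ne (a b : ℕ) : ∃ c < 4, b ≠ c ∧ c ≠ a := by
  by_cases h0 : a ≠ 0 ∧ b ≠ 0
  · exact ⟨0, by omega⟩
  by_cases h1 : a ≠ 1 ∧ b ≠ 1
  · exact ⟨1, by omega⟩
  exact ⟨2, by omega⟩

lemma exists_extend_pendant {a b a' b' : ℕ} {E : List ℕ} (hE : Moves a a' E)
    (ha : a < 4) (hb : b < 4) (hab : b ≠ a) (hb' : b' < 4) (hab' : b' ≠ a') :
    ∃ T : List (ℕ × ℕ), (∀ e ∈ T, e.1 = a ∨ e.1 = b) ∧ own a T = E ∧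
      Moves b b' (own b T) ∧ pairOK a b (pr a b T) := by
  obtain ⟨c, hc, hbc, hac⟩ := exists_lt_four_ne a b
  obtain ⟨c', hc', hbc', hac'⟩ := exists_lt_four_ne a' b'
  obtain ⟨T, hT, h1, h2, -, h3, -, -⟩ :=
    exists_extend_triangle hE ha hb hc hab hac hbc hb' hc' hab' hac' hbc'
  refine ⟨T.filter fun e => e.1 != c, ?_, ?_, ?_, ?_⟩
  · intro e he
    have h4 := hT e (List.mem_filter.1 he).1
    have h5 := (List.mem_filter.1 he).2
    simp at h5
    tauto
  · rw [own_filter (p := fun i => i != c) (by simpa using hac.symm), h1]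
  · rwa [own_filter (p := fun i => i != c) (by simpa using hbc)]
  · rwa [pr_filter (p := fun i => i != c) (by simpa using hac.symm) (by simpa using hbc)]

/-! ### Merging timelines -/

lemma exists_merge {X : Type} (N D : X → Bool) (L E : List X) (hL : ∀ e ∈ L, D e = false) (hE : ∀ e ∈ E, N e = true ∨ D e = true)
    (h : L.filter N = E.filter fun e => !D e) :
    ∃ L' : List X, (L'.filter fun e => !D e) = L ∧ (L'.filter fun e => N e || D e) = E := by
  induction L generalizing E with
  | nil =>
    have h1 : ∀ e ∈ E, D e = true := by
      have := List.filter_eq_nil_iff.1 h.symm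
      simpa using this
    refine ⟨E, ?_, ?_⟩
    · simpa [List.filter_eq_nil_iff] using h1
    · rw [List.filter_eq_self]; intro e he; simp [h1 e he]
  | cons l L ih =>
    have hl : D l = false := hL l (by simp)
    have hL' : ∀ e ∈ L, D e = false := fun e he => hL e (by simp [he])
    by_cases hN : N l = true
    · induction E with
      | nil => simp [hN] at h
      | cons e E ihE =>
        have hE' : ∀ e ∈ E, N e = true ∨ D e = true := fun e he => hE e (by simp [he])
        by_cases hD : D e = true
        · obtain ⟨L', h1, h2⟩ := ihE hE' (by simpa [hN, hD] using h)
          exact ⟨e :: L', by simp [hD, h1], by simp [hD, h2]⟩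
        · simp only [hN, List.filter_cons_of_pos, hD, Bool.not_false, List.cons.injEq] at h
          obtain ⟨rfl, h⟩ := h
          obtain ⟨L', h1, h2⟩ := ih E hL' hE' h
          exact ⟨l :: L', by simp [hl, h1], by simp [hN, h2]⟩
    · obtain ⟨L', h1, h2⟩ := ih E hL' hE (by simpa [hN] using h)
      exact ⟨l :: L', by simp [hl, h1], by simp [hN, hl, h2]⟩

section Stage
variable {V : Type} [DecidableEq V] [Nonempty V]

/-- Insert into `L` the events of the vertices in `D`, which follow the colors of `T`. -/
lemma exists_insert {α : V → ℕ} {S A D : Finset V} {rep : V → V} {L : List (V × ℕ)}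
    (hAS : A ⊆ S) (hDS : Disjoint D S) (hrep : ∀ v ∈ S, rep v ∈ S ∧ α (rep v) = α v)
    (hL : ∀ e ∈ L, e.1 ∈ S) (hA : ∀ u ∈ A, ∀ w ∈ A, α u = α w → rep u = rep w)
    {T : List (ℕ × ℕ)} (hT : ∀ e ∈ T, e.1 ∈ (A ∪ D).image α)
    (hLT : ∀ j : ℕ → V, (∀ u ∈ A, j (α u) = rep u) →
      (L.filter fun e => decide (e.1 ∈ A.image rep)) =
        (T.filter fun e => decide (e.1 ∈ A.image α)).map (Prod.map j id)) :
    ∃ (rep' : V → V) (L' : List (V × ℕ)),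
      (∀ v ∈ S, rep' v = rep v) ∧ (∀ v ∈ D, rep' v ∈ S ∪ D ∧ α (rep' v) = α v) ∧
      (∀ e ∈ L', e.1 ∈ S ∪ D) ∧
      (∀ u ∈ S, own (rep u) L' = own (rep u) L) ∧
      (∀ u ∈ S, ∀ w ∈ S, pr (rep u) (rep w) L' = pr (rep u) (rep w) L) ∧
      (∀ u ∈ A ∪ D, own (rep' u) L' = own (α u) T) ∧
      ∀ u ∈ A ∪ D, ∀ w ∈ A ∪ D, (α u = α w → rep' u = rep' w) ∧
        pr (rep' u) (rep' w) L' = pr (α u) (α w) T := by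
  classical
  have hj : ∀ q, ∃ x : V, q ∈ (A ∪ D).image α →
      (α x = q ∧ (∀ u ∈ A, α u = q → x = rep u) ∧ ((∀ u ∈ A, α u ≠ q) → x ∈ D)) ∧ x ∈ S ∪ D := by
    intro q
    by_cases h1 : ∃ u ∈ A, α u = q
    · obtain ⟨u, hu, rfl⟩ := h1
      exact ⟨rep u, fun _ => ⟨⟨(hrep u (hAS hu)).2, fun w hw h => hA u hu w hw h.symm,
        fun h => absurd rfl (h u hu)⟩, Finset.mem_union_left _ (hrep u (hAS hu)).1⟩⟩
    · push Not at h1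
      by_cases h2 : ∃ d ∈ D, α d = q
      · obtain ⟨d, hd, rfl⟩ := h2
        exact ⟨d, fun _ => ⟨⟨rfl, fun u hu h => absurd h (h1 u hu), fun _ => hd⟩,
          Finset.mem_union_right _ hd⟩⟩
      · refine ⟨Classical.arbitrary V, fun h => ?_⟩
        obtain ⟨x, hx, rfl⟩ := Finset.mem_image.1 h
        rcases Finset.mem_union.1 hx with hx | hx
        · exact absurd rfl (h1 x hx)
        · exact absurd ⟨x, hx, rfl⟩ h2
  choose j hj using hj
  have hjA : ∀ u ∈ A, j (α u) = rep u := fun u hu =>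
    (hj (α u) (Finset.mem_image_of_mem α (Finset.mem_union_left _ hu))).1.2.1 u hu rfl
  have hjα : ∀ q ∈ (A ∪ D).image α, α (j q) = q := fun q hq => (hj q hq).1.1
  have hjmem : ∀ q ∈ (A ∪ D).image α, j q ∈ A.image rep ∨ j q ∈ D := by
    intro q hq
    by_cases h : ∀ u ∈ A, α u ≠ q
    · exact Or.inr ((hj q hq).1.2.2 h)
    · push Not at h
      obtain ⟨u, hu, rfl⟩ := h
      exact Or.inl (by rw [hjA u hu]; exact Finset.mem_image_of_mem _ hu)
  have hrepS : ∀ u ∈ A, rep u ∈ S := fun u hu => (hrep u (hAS hu)).1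
  have hND : ∀ x ∈ A.image rep, x ∉ D := by
    intro x hx hD
    obtain ⟨u, hu, rfl⟩ := Finset.mem_image.1 hx
    exact Finset.disjoint_left.1 hDS hD (hrepS u hu)
  have hE : (T.map (Prod.map j id)).filter (fun e => !decide (e.1 ∈ D)) =
      (T.filter fun e => decide (e.1 ∈ A.image α)).map (Prod.map j id) := by
    rw [List.filter_map]
    congr 1
    refine List.filter_congr fun e he => ?_
    have h1 := hj e.1 (hT e he)
    simp only [Function.comp_def, Prod.map_fst, ← decide_not, decide_eq_decide, Finset.mem_image]
    constructor
    · intro h2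
      by_contra h3
      push Not at h3
      exact h2 (h1.1.2.2 h3)
    · rintro ⟨u, hu, h2⟩ h3
      rw [← h2, hjA u hu] at h3
      exact hND _ (Finset.mem_image_of_mem _ hu) h3
  obtain ⟨L', h1, h2⟩ := exists_merge (fun e : V × ℕ => decide (e.1 ∈ A.image rep))
    (fun e => decide (e.1 ∈ D)) L (T.map (Prod.map j id))
    (fun e he => by simpa using Finset.disjoint_right.1 hDS (hL e he))
    (fun e he => by
      obtain ⟨e', he', rfl⟩ := List.mem_map.1 he
      simpa using hjmem _ (hT e' he'))
    (by rw [hE]; exact hLT j hjA)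
  have hnotD : ∀ u ∈ S, (!decide (rep u ∈ D)) = true := fun u hu => by
    simpa using Finset.disjoint_right.1 hDS (hrep u hu).1
  let rep' : V → V := fun v => if v ∈ D then j (α v) else rep v
  have hrep' : ∀ u ∈ A ∪ D, rep' u = j (α u) := by
    intro u hu
    by_cases hD : u ∈ D
    · simp [rep', hD]
    · rw [hjA u ((Finset.mem_union.1 hu).resolve_right hD)]; simp [rep', hD]
  have hlab : ∀ u ∈ A ∪ D, ∀ e ∈ T, j e.1 = j (α u) → e.1 = α u := by
    intro u hu e he h
    rw [← hjα _ (hT e he), h, hjα _ (Finset.mem_image_of_mem _ hu)]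
  have hp : ∀ u ∈ A ∪ D, (decide (j (α u) ∈ A.image rep) || decide (j (α u) ∈ D)) = true := by
    intro u hu
    simpa using hjmem _ (Finset.mem_image_of_mem α hu)
  refine ⟨rep', L', ?_, ?_, ?_, ?_, ?_, ?_, ?_⟩
  · intro v hv
    have : v ∉ D := Finset.disjoint_right.1 hDS hv
    simp [rep', this]
  · intro v hv
    have := hj (α v) (Finset.mem_image_of_mem α (Finset.mem_union_right _ hv))
    rw [hrep' v (Finset.mem_union_right _ hv)]
    exact ⟨this.2, this.1.1⟩
  · intro e he
    by_cases hD : e.1 ∈ D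
    · exact Finset.mem_union_right _ hD
    · refine Finset.mem_union_left _ (hL e ?_)
      rw [← h1]
      simp [he, hD]
  · intro u hu
    rw [← own_filter (p := fun x => !decide (x ∈ D)) (hnotD u hu), h1]
  · intro u hu w hw
    rw [← pr_filter (p := fun x => !decide (x ∈ D)) (hnotD u hu) (hnotD w hw), h1]
  · intro u hu
    rw [hrep' u hu, ← own_filter (p := fun x => decide (x ∈ A.image rep) || decide (x ∈ D))
      (hp u hu), h2, own_map (hlab u hu), List.map_id]
  · intro u hu w hw
    refine ⟨fun h => by rw [hrep' u hu, hrep' w hw, h], ?_⟩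
    rw [hrep' u hu, hrep' w hw,
      ← pr_filter (p := fun x => decide (x ∈ A.image rep) || decide (x ∈ D))
      (hp u hu) (hp w hw), h2, pr_map (hlab u hu) (hlab w hw), Prod.map_id, List.map_id]
end Stage

section Stage
variable {V : Type} [DecidableEq V] [Nonempty V]

/-- The events `L`, acting on the classes of `rep`, form a valid stage for the graph induced by
`G` on `S`; along the pairs related by `M`, one can attach further vertices. -/
structure StageState (R t : ℕ) (G : SimpleGraph V) (M : V → V → Prop) (S : Finset V) (α : V → ℕ)
    (rep : V → V) (L : List (V × ℕ)) : Prop where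
  rep_mem : ∀ v ∈ S, rep v ∈ S ∧ α (rep v) = α v
  mem : ∀ e ∈ L, e.1 ∈ S
  token : ∀ v ∈ S, vt R t (α v) (own (rep v) L) ∧ nt (α v) (own (rep v) L)
  ident : ∀ u ∈ S, ∀ w ∈ S, G.Adj u w → α u = α w → rep u = rep w
  pair : ∀ u ∈ S, ∀ w ∈ S, G.Adj u w → α u ≠ α w → pairOK (α u) (α w) (pr (rep u) (rep w) L)
  good : ∀ u ∈ S, ∀ w ∈ S, M u w → α u ≠ α w → fl R t (α u) (α w) (pr (rep u) (rep w) L)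

def StageOK (R t : ℕ) (G : SimpleGraph V) (M : V → V → Prop) (S : Finset V) : Prop :=
  ∀ α : V → ℕ, (t = 4 → ∀ v, α v < 5) → ∃ rep L, StageState R t G M S α rep L

lemma StageState.insert {R t : ℕ} {G G' : SimpleGraph V} {M M' : V → V → Prop}
    {S A D : Finset V} {α : V → ℕ} {rep : V → V} {L : List (V × ℕ)}
    (h : StageState R t G M S α rep L) (hAS : A ⊆ S) (hDS : Disjoint D S)
    (hG : ∀ u ∈ S, ∀ w ∈ S, G'.Adj u w → G.Adj u w)
    (hM : ∀ u ∈ S, ∀ w ∈ S, M' u w → M u w) (hMs : ∀ u w, M' u w → M' w u)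
    (hA : ∀ u ∈ A, ∀ w ∈ A, α u = α w → rep u = rep w)
    (hMG : ∀ u w, M' u w → G'.Adj u w)
    (hDA : ∀ v ∈ D, ∀ y ∈ S, G'.Adj v y → y ∈ A)
    {T : List (ℕ × ℕ)} (hT : ∀ e ∈ T, e.1 ∈ (A ∪ D).image α)
    (hLT : ∀ j : ℕ → V, (∀ u ∈ A, j (α u) = rep u) →
      (L.filter fun e => decide (e.1 ∈ A.image rep)) =
        (T.filter fun e => decide (e.1 ∈ A.image α)).map (Prod.map j id))
    (htok : ∀ v ∈ D, vt R t (α v) (own (α v) T) ∧ nt (α v) (own (α v) T))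
    (hpair : ∀ v ∈ D, ∀ y ∈ A ∪ D, G'.Adj v y → α v ≠ α y →
      pairOK (α v) (α y) (pr (α v) (α y) T))
    (hgood : ∀ v ∈ D, ∀ y ∈ A ∪ D, M' v y → α v ≠ α y →
      fl R t (α v) (α y) (pr (α v) (α y) T)) :
    ∃ rep' L', StageState R t G' M' (S ∪ D) α rep' L' := by
  obtain ⟨rep', L', hS, hD, hL', hown, hpr, hown', hpr'⟩ :=
    exists_insert hAS hDS h.rep_mem h.mem hA hT hLT
  have key : ∀ v ∈ D, ∀ y ∈ S ∪ D, G'.Adj v y → y ∈ A ∪ D := by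
    intro v hv y hy hvy
    rcases Finset.mem_union.1 hy with hy | hy
    · exact Finset.mem_union_left _ (hDA v hv y hy hvy)
    · exact Finset.mem_union_right _ hy
  have hDm : ∀ v ∈ D, v ∈ A ∪ D := fun v hv => Finset.mem_union_right _ hv
  refine ⟨rep', L', ?_, hL', ?_, ?_, ?_, ?_⟩
  · intro v hv
    rcases Finset.mem_union.1 hv with hv | hv
    · rw [hS v hv]
      exact ⟨Finset.mem_union_left _ (h.rep_mem v hv).1, (h.rep_mem v hv).2⟩
    · exact hD v hv
  · intro v hv
    rcases Finset.mem_union.1 hv with hv | hv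
    · rw [hS v hv, hown v hv]
      exact h.token v hv
    · rw [hown' v (hDm v hv)]
      exact htok v hv
  · intro u hu w hw huw hα
    rcases Finset.mem_union.1 hu with hu' | hu'
    · rcases Finset.mem_union.1 hw with hw' | hw'
      · rw [hS u hu', hS w hw']
        exact h.ident u hu' w hw' (hG u hu' w hw' huw) hα
      · exact (hpr' u (key w hw' u hu huw.symm) w (hDm w hw')).1 hα
    · exact (hpr' u (hDm u hu') w (key u hu' w hw huw)).1 hα
  · intro u hu w hw huw hα
    rcases Finset.mem_union.1 hu with hu' | hu'
    · rcases Finset.mem_union.1 hw with hw' | hw'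
      · rw [hS u hu', hS w hw', hpr u hu' w hw']
        exact h.pair u hu' w hw' (hG u hu' w hw' huw) hα
      · have h1 := key w hw' u hu huw.symm
        rw [(hpr' u h1 w (hDm w hw')).2, pr_swap hα.symm, pairOK_flip]
        exact hpair w hw' u h1 huw.symm hα.symm
    · have h1 := key u hu' w hw huw
      rw [(hpr' u (hDm u hu') w h1).2]
      exact hpair u hu' w h1 huw hα
  · intro u hu w hw hM' hα
    have huw := hMG u w hM'
    rcases Finset.mem_union.1 hu with hu' | hu'
    · rcases Finset.mem_union.1 hw with hw' | hw'
      · rw [hS u hu', hS w hw', hpr u hu' w hw']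
        exact h.good u hu' w hw' (hM u hu' w hw' hM') hα
      · have h1 := key w hw' u hu huw.symm
        rw [(hpr' u h1 w (hDm w hw')).2, pr_swap hα.symm, fl_flip]
        exact hgood w hw' u h1 (hMs _ _ hM') hα.symm
    · have h1 := key u hu' w hw huw
      rw [(hpr' u (hDm u hu') w h1).2]
      exact hgood u hu' w h1 hM' hα

lemma exists_timeline {R t : ℕ} (hs : StageParams R t) (c : ℕ) :
    ∃ T : List (ℕ × ℕ), (∀ e ∈ T, e.1 = c) ∧ vt R t c (own c T) ∧ nt c (own c T) := by
  by_cases hc : c < t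
  · exact ⟨[], by simp, by simp [vt_iff, hc], rfl⟩
  · have h4 : 0 < t ∧ 1 ≤ R := by
      rcases hs with ⟨rfl, rfl⟩ | ⟨rfl, rfl⟩ <;> simp
    refine ⟨[(c, 0)], by simp, ?_, ?_⟩
    · simp [own_cons, vt_iff, h4.1]; omega
    · simp [own_cons, nt]; omega

lemma own_map_mk {κ : Type} [DecidableEq κ] (a : κ) (E : List ℕ) :
    own a (E.map fun q => (a, q)) = E := by
  induction E with
  | nil => rfl
  | cons q E ih => simp [own_cons, ih]

lemma pr_map_mk {κ : Type} [DecidableEq κ] {a b : κ} (hab : a ≠ b) (E : List (Bool × ℕ)) :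
    pr a b (E.map fun e => (bif e.1 then b else a, e.2)) = E := by
  induction E with
  | nil => rfl
  | cons e E ih => obtain ⟨_ | _, q⟩ := e <;> simp [pr_cons, ih, hab.symm]

/-- Extension by one vertex whose color may coincide with that of its neighbour. -/
lemma exists_attach_one {R t : ℕ} (hs : StageParams R t) {a c : ℕ} {E : List ℕ}
    (hE : vt R t a E) (hnt : nt a E) (hin : t = 4 → a < 5 ∧ c < 5) :
    ∃ T : List (ℕ × ℕ), (∀ e ∈ T, e.1 = a ∨ e.1 = c) ∧ own a T = E ∧
      (vt R t c (own c T) ∧ nt c (own c T)) ∧ (c ≠ a → fl R t c a (pr c a T)) := by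
  by_cases hca : c = a
  · subst hca
    exact ⟨E.map fun q => (c, q), by simp, own_map_mk c E, by rw [own_map_mk]; exact ⟨hE, hnt⟩,
      fun h => absurd rfl h⟩
  · obtain ⟨T, h1, h2, h3⟩ := exists_extend_one hs hE hnt hca hin
    have h4 := own_true_pr (Ne.symm hca) T
    refine ⟨T, h1, h2, ?_, fun _ => ?_⟩
    · rw [← h4]
      exact ⟨fl_right h3, nt_right (fl_pairOK h3)⟩
    · rw [pr_swap (Ne.symm hca), fl_flip]; exact h3

/-- Extension by one vertex whose color may coincide with that of one of its neighbours. -/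
lemma exists_attach_pair {R t : ℕ} (hs : StageParams R t) {a b c : ℕ} {E : List (Bool × ℕ)}
    (hE : fl R t a b E) (hin : t = 4 → a < 5 ∧ b < 5 ∧ c < 5) :
    ∃ T : List (ℕ × ℕ), (∀ e ∈ T, e.1 = a ∨ e.1 = b ∨ e.1 = c) ∧ pr a b T = E ∧
      (vt R t c (own c T) ∧ nt c (own c T)) ∧ (c ≠ a → fl R t c a (pr c a T)) ∧
      (c ≠ b → fl R t c b (pr c b T)) := by
  have hab := pairOK_ne (fl_pairOK hE)
  have hT : ∀ e ∈ E.map (fun e => ((bif e.1 then b else a), e.2)), e.1 = a ∨ e.1 = b := by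
    intro e he
    obtain ⟨⟨_ | _, q⟩, -, rfl⟩ := List.mem_map.1 he <;> simp
  have hpr := pr_map_mk hab E
  set T := E.map (fun e => ((bif e.1 then b else a), e.2))
  by_cases hca : c = a
  · subst hca
    refine ⟨T, fun e he => by have := hT e he; tauto, hpr, ?_, fun h => absurd rfl h, fun _ => ?_⟩
    · rw [← own_false_pr (w := b), hpr]; exact ⟨fl_left hE, nt_left (fl_pairOK hE)⟩
    · rw [hpr]; exact hE
  by_cases hcb : c = b
  · subst hcb
    refine ⟨T, fun e he => by have := hT e he; tauto, hpr, ?_, fun _ => ?_, fun h => absurd rfl h⟩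
    · rw [← own_true_pr hab, hpr]; exact ⟨fl_right hE, nt_right (fl_pairOK hE)⟩
    · rw [pr_swap hab, hpr, fl_flip]; exact hE
  obtain ⟨T, h1, h2, h3, h4⟩ := exists_extend_pair hs hE hca hcb hin
  refine ⟨T, h1, h2, ?_, fun _ => ?_, fun _ => ?_⟩
  · rw [← own_true_pr (Ne.symm hca) T]
    exact ⟨fl_right h3, nt_right (fl_pairOK h3)⟩
  · rw [pr_swap (Ne.symm hca), fl_flip]; exact h3
  · rw [pr_swap (Ne.symm hcb), fl_flip]; exact h4

end Stage

lemma filter_one_eq_map {V : Type} [DecidableEq V] {α : V → ℕ} {rep : V → V} {L : List (V × ℕ)} {u : V}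
    {T : List (ℕ × ℕ)} (hT : own (α u) T = own (rep u) L) (j : ℕ → V)
    (hj : ∀ y ∈ ({u} : Finset V), j (α y) = rep y) :
    (L.filter fun e => decide (e.1 ∈ ({u} : Finset V).image rep)) =
      (T.filter fun e => decide (e.1 ∈ ({u} : Finset V).image α)).map (Prod.map j id) := by
  have h1 := hj u (by simp)
  simp only [Finset.image_singleton, Finset.mem_singleton]
  rw [filter_eq_own, filter_eq_own, hT, List.map_map]
  refine List.map_congr_left ?_
  intro q _; simp [h1]

section Stage
variable {V : Type} [DecidableEq V]

lemma filter_pair_eq_map {R t : ℕ} {G : SimpleGraph V} {M : V → V → Prop} {S : Finset V}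
    {α : V → ℕ} {rep : V → V} {L : List (V × ℕ)} (h : StageState R t G M S α rep L) {u w : V}
    (hu : u ∈ S) (hw : w ∈ S) (hα : α u ≠ α w) {T : List (ℕ × ℕ)}
    (hT : pr (α u) (α w) T = pr (rep u) (rep w) L) (j : ℕ → V)
    (hj : ∀ y ∈ ({u, w} : Finset V), j (α y) = rep y) :
    (L.filter fun e => decide (e.1 ∈ ({u, w} : Finset V).image rep)) =
      (T.filter fun e => decide (e.1 ∈ ({u, w} : Finset V).image α)).map (Prod.map j id) := by
  have hr : rep u ≠ rep w := fun h' => hα (by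
    rw [← (h.rep_mem u hu).2, h', (h.rep_mem w hw).2])
  have h1 := hj u (by simp)
  have h2 := hj w (by simp)
  simp only [Finset.image_insert, Finset.image_singleton, Finset.mem_insert, Finset.mem_singleton]
  rw [filter_eq_pr, filter_eq_pr, hT, List.map_map]
  refine List.map_congr_left ?_
  rintro ⟨_ | _, q⟩ _ <;> simp [h1, h2]

variable [Nonempty V] {R t : ℕ} {G G' : SimpleGraph V} {M M' : V → V → Prop} {S : Finset V}

lemma StageOK.attach_isolated (hs : StageParams R t) (h : StageOK R t G M S) {v : V} (hv : v ∉ S)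
    (hG : ∀ u ∈ S, ∀ w ∈ S, G'.Adj u w → G.Adj u w)
    (hM : ∀ u ∈ S, ∀ w ∈ S, M' u w → M u w) (hMs : ∀ u w, M' u w → M' w u)
    (hMG : ∀ u w, M' u w → G'.Adj u w) (hN : ∀ y ∈ S, ¬ G'.Adj v y) :
    StageOK R t G' M' (S ∪ {v}) := by
  intro α hα
  obtain ⟨rep, L, hL⟩ := h α hα
  obtain ⟨T, hT, hT'⟩ := exists_timeline hs (α v)
  refine hL.insert (A := ∅) (T := T) (by simp) (by simpa using hv) hG hM hMs (by simp) hMG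
    ?_ ?_ ?_ ?_ ?_ ?_
  · intro x hx y hy hxy
    rw [Finset.mem_singleton.1 hx] at hxy
    exact absurd hxy (hN y hy)
  · intro e he; simp [hT e he]
  · intro j _; simp
  · intro x hx; rw [Finset.mem_singleton.1 hx]; exact hT'
  · intro x hx y hy _ h'
    simp at hx hy; subst hx hy; exact absurd rfl h'
  · intro x hx y hy _ h'
    simp at hx hy; subst hx hy; exact absurd rfl h'

lemma StageState.attach_one (hs : StageParams R t) {α : V → ℕ} {rep : V → V} {L : List (V × ℕ)}
    (h : StageState R t G M S α rep L) (hα : t = 4 → ∀ v, α v < 5)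
    {v : V} (hv : v ∉ S) {A : Finset V} (hAS : A ⊆ S) {u : V} (hu : u ∈ A)
    (hA : ∀ y ∈ A, α y = α u ∧ rep y = rep u)
    (hG : ∀ u ∈ S, ∀ w ∈ S, G'.Adj u w → G.Adj u w)
    (hM : ∀ u ∈ S, ∀ w ∈ S, M' u w → M u w) (hMs : ∀ u w, M' u w → M' w u)
    (hMG : ∀ u w, M' u w → G'.Adj u w) (hN : ∀ y ∈ S, G'.Adj v y → y ∈ A) :
    ∃ rep' L', StageState R t G' M' (S ∪ {v}) α rep' L' := by
  have ht := h.token u (hAS hu)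
  obtain ⟨T, hT, hown, htok, hfl⟩ := exists_attach_one hs ht.1 ht.2
    (fun h4 => ⟨hα h4 u, hα h4 v⟩)
  refine h.insert (A := A) (T := T) hAS (by simpa using hv) hG hM hMs ?_ hMG ?_ ?_ ?_ ?_ ?_ ?_
  · intro x hx y hy _; rw [(hA x hx).2, (hA y hy).2]
  · intro x hx y hy hxy
    rw [Finset.mem_singleton.1 hx] at hxy
    exact hN y hy hxy
  · intro e he
    rcases hT e he with h' | h' <;> rw [h']
    · exact Finset.mem_image_of_mem _ (Finset.mem_union_left _ hu)
    · exact Finset.mem_image_of_mem _ (by simp)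
  · intro j hj
    have h1 : A.image rep = ({u} : Finset V).image rep := by
      ext z; simp only [Finset.mem_image, Finset.mem_singleton]
      exact ⟨fun ⟨y, hy, e⟩ => ⟨u, rfl, by rw [← e, (hA y hy).2]⟩,
        fun ⟨y, hy, e⟩ => ⟨u, hu, by rw [← e, hy]⟩⟩
    have h2 : A.image α = ({u} : Finset V).image α := by
      ext z; simp only [Finset.mem_image, Finset.mem_singleton]
      exact ⟨fun ⟨y, hy, e⟩ => ⟨u, rfl, by rw [← e, (hA y hy).1]⟩,
        fun ⟨y, hy, e⟩ => ⟨u, hu, by rw [← e, hy]⟩⟩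
    rw [h1, h2]
    exact filter_one_eq_map hown j (by simpa using hj u hu)
  · intro x hx; rw [Finset.mem_singleton.1 hx]; exact htok
  · intro x hx y hy _ h'
    rw [Finset.mem_singleton.1 hx] at h' ⊢
    rcases Finset.mem_union.1 hy with hy | hy
    · rw [(hA y hy).1] at h' ⊢; exact fl_pairOK (hfl h')
    · rw [Finset.mem_singleton.1 hy] at h'; exact absurd rfl h'
  · intro x hx y hy _ h'
    rw [Finset.mem_singleton.1 hx] at h' ⊢
    rcases Finset.mem_union.1 hy with hy | hy
    · rw [(hA y hy).1] at h' ⊢; exact hfl h'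
    · rw [Finset.mem_singleton.1 hy] at h'; exact absurd rfl h'

lemma StageOK.attach_pendant (hs : StageParams R t) (h : StageOK R t G M S) {v u : V}
    (hv : v ∉ S) (hu : u ∈ S) (hG : ∀ u ∈ S, ∀ w ∈ S, G'.Adj u w → G.Adj u w)
    (hM : ∀ u ∈ S, ∀ w ∈ S, M' u w → M u w) (hMs : ∀ u w, M' u w → M' w u)
    (hMG : ∀ u w, M' u w → G'.Adj u w) (hN : ∀ y ∈ S, G'.Adj v y → y = u) :
    StageOK R t G' M' (S ∪ {v}) := by
  intro α hα
  obtain ⟨rep, L, hL⟩ := h α hα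
  exact hL.attach_one hs hα hv (A := {u}) (u := u) (by simpa using hu) (by simp) (by simp)
    hG hM hMs hMG (by simpa using hN)

lemma StageOK.attach_ear (hs : StageParams R t) (h : StageOK R t G M S) {v u w : V}
    (hv : v ∉ S) (hu : u ∈ S) (hw : w ∈ S) (huw : M u w) (huw' : G.Adj u w)
    (hG : ∀ u ∈ S, ∀ w ∈ S, G'.Adj u w → G.Adj u w)
    (hM : ∀ u ∈ S, ∀ w ∈ S, M' u w → M u w) (hMs : ∀ u w, M' u w → M' w u)
    (hMG : ∀ u w, M' u w → G'.Adj u w) (hN : ∀ y ∈ S, G'.Adj v y → y = u ∨ y = w) :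
    StageOK R t G' M' (S ∪ {v}) := by
  intro α hα
  obtain ⟨rep, L, hL⟩ := h α hα
  by_cases hc : α u = α w
  · have hr := hL.ident u hu w hw huw' hc
    refine hL.attach_one hs hα hv (A := {u, w}) (u := u) ?_ (by simp) ?_
      hG hM hMs hMG (by simpa using hN)
    · intro y hy; simp at hy; rcases hy with rfl | rfl <;> assumption
    · intro y hy; simp at hy; rcases hy with rfl | rfl
      · simp
      · exact ⟨hc.symm, hr.symm⟩
  · have hfl := hL.good u hu w hw huw hc
    obtain ⟨T, hT, hpr, htok, h1, h2⟩ := exists_attach_pair (c := α v) hs hfl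
      (fun h4 => ⟨hα h4 u, hα h4 w, hα h4 v⟩)
    have hfl' : ∀ x ∈ ({v} : Finset V), ∀ y ∈ ({u, w} : Finset V) ∪ {v}, α x ≠ α y →
        fl R t (α x) (α y) (pr (α x) (α y) T) := by
      intro x hx y hy h'
      simp at hx hy
      subst hx
      rcases hy with rfl | rfl | rfl
      · exact h1 h'
      · exact h2 h'
      · exact absurd rfl h'
    refine hL.insert (A := {u, w}) (T := T) ?_ (by simpa using hv) hG hM hMs ?_ hMG ?_ ?_ ?_ ?_ ?_ ?_
    · intro y hy; simp at hy; rcases hy with rfl | rfl <;> assumption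
    · intro x hx y hy h'
      simp at hx hy
      rcases hx with rfl | rfl <;> rcases hy with rfl | rfl <;> first | rfl | exact absurd h' hc | exact absurd h'.symm hc
    · intro x hx y hy hxy
      rw [Finset.mem_singleton.1 hx] at hxy
      simpa using hN y hy hxy
    · intro e he
      rcases hT e he with h' | h' | h' <;> rw [h'] <;>
        exact Finset.mem_image_of_mem _ (by simp)
    · exact fun j hj => filter_pair_eq_map hL hu hw hc hpr j hj
    · intro x hx; rw [Finset.mem_singleton.1 hx]; exact htok
    · exact fun x hx y hy _ h' => fl_pairOK (hfl' x hx y hy h')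
    · exact fun x hx y hy _ h' => hfl' x hx y hy h'

lemma StageOK.attach_clique (hs : StageParams R t) (h : StageOK R t G M S) {x : V}
    {D : Finset V} (hx : x ∈ S) (hD : Disjoint D S) (hD3 : D.card ≤ 3)
    (hG : ∀ u ∈ S, ∀ w ∈ S, G'.Adj u w → G.Adj u w)
    (hM : ∀ u ∈ S, ∀ w ∈ S, M' u w → M u w) (hMs : ∀ u w, M' u w → M' w u)
    (hMG : ∀ u w, M' u w → G'.Adj u w) (hN : ∀ v ∈ D, ∀ y ∈ S, G'.Adj v y → y = x)
    (hM' : ∀ v ∈ D, ∀ y, ¬ M' v y) :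
    StageOK R t G' M' (S ∪ D) := by
  intro α hα
  obtain ⟨rep, L, hL⟩ := h α hα
  have ht := hL.token x hx
  set l := ((D.image α).erase (α x)).toList with hl
  have hmem : ∀ c, c ∈ α x :: l ↔ c ∈ (({x} : Finset V) ∪ D).image α := by
    intro c
    simp only [hl, List.mem_cons, Finset.mem_toList, Finset.mem_erase, Finset.image_union,
      Finset.image_singleton, Finset.mem_union, Finset.mem_singleton]
    tauto
  obtain ⟨T, hT, hown, htok, hpair⟩ := exists_extend_clique (l := l) hs ht.1 ht.2
    (by simp [hl, Finset.nodup_toList])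
    (by
      rw [hl, Finset.length_toList]
      exact (Finset.card_erase_le.trans Finset.card_image_le).trans hD3)
    (by
      intro h4 c hc
      obtain ⟨y, -, rfl⟩ := Finset.mem_image.1 ((hmem c).1 hc)
      exact hα h4 y)
  have hm : ∀ v ∈ ({x} : Finset V) ∪ D, α v ∈ α x :: l :=
    fun v hv => (hmem _).2 (Finset.mem_image_of_mem _ hv)
  refine hL.insert (A := {x}) (T := T) (by simpa using hx) hD hG hM hMs (by simp) hMG
    ?_ ?_ ?_ ?_ ?_ ?_
  · intro v hv y hy hvy
    simpa using hN v hv y hy hvy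
  · exact fun e he => (hmem _).1 (hT e he)
  · exact fun j hj => filter_one_eq_map hown j hj
  · exact fun v hv => htok _ (hm v (Finset.mem_union_right _ hv))
  · exact fun v hv y hy _ h' => hpair _ (hm v (Finset.mem_union_right _ hv)) _ (hm y hy) h'
  · exact fun v hv y _ h' => absurd h' (hM' v hv y)

end Stage

section Structure
variable {V : Type} {G G' : SimpleGraph V}

/-- `B` is nonempty and no nonempty proper subset of `B` is closed under adjacency in `B`. -/
def Linked (G : SimpleGraph V) (B : Set V) : Prop :=
  B.Nonempty ∧ ∀ T ⊆ B, T.Nonempty → (∀ x ∈ T, ∀ y ∈ B, G.Adj x y → y ∈ T) → B ⊆ T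

/-- Two hubs joined through three disjoint connected sets. -/
def HasTheta (G : SimpleGraph V) : Prop :=
  ∃ (h k : V) (B : Fin 3 → Set V), h ≠ k ∧ (∀ i, h ∉ B i ∧ k ∉ B i) ∧
    (∀ i j, i ≠ j → ∀ x ∈ B i, x ∉ B j) ∧ (∀ i, Linked G (B i)) ∧
    ∀ i, (∃ x ∈ B i, G.Adj h x) ∧ ∃ x ∈ B i, G.Adj k x

lemma Linked.mono {B : Set V} (hG : ∀ x ∈ B, ∀ y ∈ B, G.Adj x y → G'.Adj x y)
    (h : Linked G B) : Linked G' B :=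
  ⟨h.1, fun T hT hne hc => h.2 T hT hne fun x hx y hy hxy => hc x hx y hy (hG x (hT hx) y hy hxy)⟩

lemma Linked.connected {B : Set V} (h : Linked G B) : (G.induce B).Connected := by
  obtain ⟨⟨x, hx⟩, hB⟩ := h
  rw [connected_iff_exists_forall_reachable]
  refine ⟨⟨x, hx⟩, ?_⟩
  have := hB {y | ∃ hy : y ∈ B, (G.induce B).Reachable ⟨x, hx⟩ ⟨y, hy⟩} (fun y hy => hy.1)
    ⟨x, hx, Reachable.refl _⟩ (by
      rintro y ⟨hy, hr⟩ z hz hyz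
      refine ⟨hz, hr.trans (Adj.reachable ?_)⟩
      simpa using hyz)
  rintro ⟨y, hy⟩
  exact (this hy).2

lemma Linked.singleton (v : V) : Linked G {v} := by
  refine ⟨⟨v, rfl⟩, ?_⟩
  rintro T hT ⟨x, hx⟩ - y rfl
  rwa [← Set.mem_singleton_iff.1 (hT hx)]

lemma HasTheta.isMinor (h : HasTheta G) :
    IsMinor (completeBipartiteGraph (Fin 2) (Fin 3)) G := by
  obtain ⟨h, k, B, hk, hB, hd, hl, ha⟩ := h
  have hhub : ∀ a : Fin 2, ∀ i : Fin 3, (![h, k] a) ∉ B i ∧ ∃ x ∈ B i, G.Adj (![h, k] a) x := by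
    intro a i
    fin_cases a
    · exact ⟨(hB i).1, (ha i).1⟩
    · exact ⟨(hB i).2, (ha i).2⟩
  have hlink : ∀ s, Linked G (Sum.elim (fun a : Fin 2 => ({![h, k] a} : Set V)) B s) := by
    rintro (a | i)
    · exact Linked.singleton _
    · exact hl i
  refine ⟨Sum.elim (fun a => {![h, k] a}) B, fun s => (hlink s).1, ?_, fun s => (hlink s).connected, ?_⟩
  · rintro (a | i) (b | j) hne
    · simp only [Sum.elim_inl, Set.disjoint_singleton]
      fin_cases a <;> fin_cases b <;> simp_all [Ne.symm]
    · exact Set.disjoint_singleton_left.2 (hhub a j).1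
    · exact Set.disjoint_singleton_right.2 (hhub b i).1
    · exact Set.disjoint_left.2 fun x hx => hd i j (by simpa using hne) x hx
  · rintro (a | i) (b | j) hadj
    · simp at hadj
    · obtain ⟨x, hx, hax⟩ := (hhub a j).2
      exact ⟨_, rfl, x, hx, hax⟩
    · obtain ⟨x, hx, hax⟩ := (hhub b i).2
      exact ⟨x, hx, _, rfl, hax.symm⟩
    · simp at hadj

lemma HasTheta.mono (hG : G ≤ G') (h : HasTheta G) : HasTheta G' := by
  obtain ⟨h, k, B, hk, hB, hd, hl, ha⟩ := h
  exact ⟨h, k, B, hk, hB, hd, fun i => (hl i).mono fun x _ y _ => @hG x y,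
    fun i => ⟨(ha i).1.imp fun x hx => ⟨hx.1, hG hx.2⟩, (ha i).2.imp fun x hx => ⟨hx.1, hG hx.2⟩⟩⟩

lemma hasTheta_of_sets {h k : V} {A B C : Set V} (hk : h ≠ k) (hA : Linked G A)
    (hB : Linked G B) (hC : Linked G C) (hAB : ∀ x ∈ A, x ∉ B) (hAC : ∀ x ∈ A, x ∉ C)
    (hBC : ∀ x ∈ B, x ∉ C) (hh : h ∉ A ∧ h ∉ B ∧ h ∉ C) (hk' : k ∉ A ∧ k ∉ B ∧ k ∉ C)
    (hA' : (∃ x ∈ A, G.Adj h x) ∧ ∃ x ∈ A, G.Adj k x)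
    (hB' : (∃ x ∈ B, G.Adj h x) ∧ ∃ x ∈ B, G.Adj k x)
    (hC' : (∃ x ∈ C, G.Adj h x) ∧ ∃ x ∈ C, G.Adj k x) : HasTheta G := by
  refine ⟨h, k, ![A, B, C], hk, ?_, ?_, ?_, ?_⟩
  · intro i; fin_cases i <;> simp [hh, hk']
  · intro i j hij
    fin_cases i <;> fin_cases j <;> first | exact absurd rfl hij | assumption | skip
    · exact fun x hx hx' => hAB x hx' hx
    · exact fun x hx hx' => hAC x hx' hx
    · exact fun x hx hx' => hBC x hx' hx
  · intro i; fin_cases i <;> assumption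
  · intro i; fin_cases i <;> assumption

/-- Adding to a linked set the midpoint of a subdivided edge. -/
lemma Linked.insert_midpoint {B : Set V} {v u w : V} (hB : Linked G' B) (hv : v ∉ B) (hu : u ∈ B)
    (hvu : G.Adj v u) (hvw : G.Adj v w)
    (hG : ∀ x y, G'.Adj x y → G.Adj x y ∨ (x = u ∧ y = w) ∨ (x = w ∧ y = u)) :
    Linked G (insert v B) := by
  refine ⟨⟨v, by simp⟩, ?_⟩
  intro T hT hne hc
  have h1 : v ∈ T → u ∈ T := fun h => hc v h u (by simp [hu]) hvu
  have h2 : B ⊆ T ∩ B := by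
    refine hB.2 _ Set.inter_subset_right ?_ ?_
    · obtain ⟨x, hx⟩ := hne
      rcases hT hx with rfl | hx'
      · exact ⟨u, h1 hx, hu⟩
      · exact ⟨x, hx, hx'⟩
    · rintro x ⟨hx, hxB⟩ y hy hxy
      refine ⟨?_, hy⟩
      rcases hG x y hxy with h | ⟨rfl, rfl⟩ | ⟨rfl, rfl⟩
      · exact hc x hx y (by simp [hy]) h
      · exact hc v (hc x hx v (by simp) hvu.symm) y (by simp [hy]) hvw
      · exact hc v (hc x hx v (by simp) hvw.symm) y (by simp [hy]) hvu
  rintro x (rfl | hx)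
  · exact hc u (h2 hu).1 x (by simp) hvu.symm
  · exact (h2 hx).1

lemma HasTheta.of_subdivision [DecidableEq V] {v u w : V} (hvu : G.Adj v u) (hvw : G.Adj v w)
    (hv : ∀ y, ¬ G'.Adj v y)
    (hG : ∀ x y, G'.Adj x y → G.Adj x y ∨ (x = u ∧ y = w) ∨ (x = w ∧ y = u))
    (h : HasTheta G') : HasTheta G := by
  obtain ⟨h, k, B, hk, hB, hd, hl, ha⟩ := h
  have hne : ∀ i x, v ∈ B i → x ∈ B i → x = v := by
    intro i x hvB hx
    exact (hl i).2 {v} (by simpa using hvB) (by simp)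
      (fun y hy z _ hyz => absurd hyz (by rw [Set.mem_singleton_iff.1 hy]; exact hv z)) hx
  have hvB : ∀ i, v ∉ B i := by
    intro i hvi
    obtain ⟨x, hx, hhx⟩ := (ha i).1
    rw [hne i x hvi hx] at hhx
    exact hv _ hhx.symm
  have hvh : h ≠ v := by rintro rfl; obtain ⟨x, -, hx⟩ := (ha 0).1; exact hv _ hx
  have hvk : k ≠ v := by rintro rfl; obtain ⟨x, -, hx⟩ := (ha 0).2; exact hv _ hx
  have key : ∀ u w, G.Adj v u → G.Adj v w →
      (∀ x y, G'.Adj x y → G.Adj x y ∨ (x = u ∧ y = w) ∨ (x = w ∧ y = u)) →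
      ∀ i, u ∈ B i → HasTheta G := by
    intro u w hvu hvw hG i hu
    have huj : ∀ j, j ≠ i → u ∉ B j := fun j hj => hd i j hj.symm u hu
    have hmem : ∀ j x, x ∈ B j → x ∈ Function.update B i (insert v (B i)) j := by
      intro j x hx
      by_cases hj : j = i
      · subst hj; simp [hx]
      · simp [hj, hx]
    have hmem' : ∀ j x, x ≠ v → x ∈ Function.update B i (insert v (B i)) j → x ∈ B j := by
      intro j x hxv hx
      by_cases hj : j = i
      · subst hj; simpa [hxv] using hx
      · simpa [hj] using hx
    have hub : ∀ g, (∀ j, g ∉ B j) → ∀ j, (∃ x ∈ B j, G'.Adj g x) →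
        ∃ x ∈ Function.update B i (insert v (B i)) j, G.Adj g x := by
      rintro g hg j ⟨x, hx, hgx⟩
      rcases hG g x hgx with h' | ⟨rfl, rfl⟩ | ⟨rfl, rfl⟩
      · exact ⟨x, hmem j x hx, h'⟩
      · exact absurd hu (hg i)
      · obtain rfl : j = i := by
          by_contra hj; exact huj j hj hx
        exact ⟨v, by simp, hvw.symm⟩
    refine ⟨h, k, Function.update B i (insert v (B i)), hk,
      fun j => ⟨fun h' => (hB j).1 (hmem' j h hvh h'), fun h' => (hB j).2 (hmem' j k hvk h')⟩,
      ?_, ?_, fun j => ⟨hub h (fun j => (hB j).1) j (ha j).1, hub k (fun j => (hB j).2) j (ha j).2⟩⟩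
    · intro a b hab x hxa hxb
      by_cases hxv : x = v
      · subst hxv
        by_cases hai : a = i
        · have hbi : b ≠ i := fun h => hab (hai.trans h.symm)
          rw [Function.update_of_ne hbi] at hxb
          exact hvB b hxb
        · rw [Function.update_of_ne hai] at hxa
          exact hvB a hxa
      · exact hd a b hab x (hmem' a x hxv hxa) (hmem' b x hxv hxb)
    · intro j
      by_cases hj : j = i
      · subst hj
        rw [Function.update_self]
        exact (hl j).insert_midpoint (hvB j) hu hvu hvw hG
      · rw [Function.update_of_ne hj]
        refine (hl j).mono fun x hx y hy hxy => ?_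
        rcases hG x y hxy with h' | ⟨rfl, rfl⟩ | ⟨rfl, rfl⟩
        · exact h'
        · exact absurd hx (huj j hj)
        · exact absurd hy (huj j hj)
  by_cases h1 : ∃ i, u ∈ B i
  · exact key u w hvu hvw hG h1.choose h1.choose_spec
  by_cases h2 : ∃ i, w ∈ B i
  · exact key w u hvw hvu (fun x y hxy => by have := hG x y hxy; tauto) h2.choose h2.choose_spec
  push Not at h1 h2
  have hGB : ∀ i, ∀ y ∈ B i, ∀ x, G'.Adj x y → G.Adj x y := by
    intro i y hy x hxy
    rcases hG x y hxy with h' | ⟨rfl, rfl⟩ | ⟨rfl, rfl⟩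
    · exact h'
    · exact absurd hy (h2 i)
    · exact absurd hy (h1 i)
  exact ⟨h, k, B, hk, hB, hd, fun i => (hl i).mono fun x _ y hy => hGB i y hy x,
    fun i => ⟨(ha i).1.imp fun x hx => ⟨hx.1, hGB i x hx.1 h hx.2⟩,
      (ha i).2.imp fun x hx => ⟨hx.1, hGB i x hx.1 k hx.2⟩⟩⟩

end Structure

section Path
variable {V : Type} {G : SimpleGraph V}

/-- Four pairwise adjacent vertices. -/
def IsK4 (G : SimpleGraph V) (u w x y : V) : Prop :=
  G.Adj u w ∧ G.Adj u x ∧ G.Adj u y ∧ G.Adj w x ∧ G.Adj w y ∧ G.Adj x y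

lemma hasTheta_of_common_neighbours {u w x y z : V} (huw : u ≠ w) (hxy : x ≠ y) (hxz : x ≠ z)
    (hyz : y ≠ z) (hux : G.Adj u x) (huy : G.Adj u y) (huz : G.Adj u z) (hwx : G.Adj w x)
    (hwy : G.Adj w y) (hwz : G.Adj w z) : HasTheta G :=
  hasTheta_of_sets (A := {x}) (B := {y}) (C := {z}) huw (Linked.singleton _) (Linked.singleton _)
    (Linked.singleton _) (by simpa using hxy) (by simpa using hxz) (by simpa using hyz)
    (by simp [hux.ne, huy.ne, huz.ne]) (by simp [hwx.ne, hwy.ne, hwz.ne])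
    (by simp [hux, hwx]) (by simp [huy, hwy]) (by simp [huz, hwz])

/-- `p 0, …, p k` is a path. -/
def IsPathSeq (G : SimpleGraph V) (p : ℕ → V) (k : ℕ) : Prop :=
  (∀ i < k, G.Adj (p i) (p (i + 1))) ∧ ∀ i ≤ k, ∀ j ≤ k, p i = p j → i = j

lemma IsPathSeq.cons {p : ℕ → V} {k : ℕ} (h : IsPathSeq G p k) {y : V} (hy : G.Adj (p 0) y)
    (hy' : ∀ i ≤ k, y ≠ p i) : IsPathSeq G (fun i => if i = 0 then y else p (i - 1)) (k + 1) := by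
  constructor
  · intro i hi
    rcases i with _ | i
    · simpa using hy.symm
    · simpa using h.1 i (by omega)
  · intro i hi j hj hij
    rcases i with _ | i <;> rcases j with _ | j
    · rfl
    · exact absurd (by simpa using hij) (hy' j (by omega))
    · exact absurd (by simpa using hij.symm) (hy' i (by omega))
    · have := h.2 i (by omega) j (by omega) (by simpa using hij)
      omega

lemma IsPathSeq.rotate {p : ℕ → V} {k i : ℕ} (h : IsPathSeq G p k) (hik : i + 1 ≤ k)
    (hi : G.Adj (p 0) (p (i + 1))) :
    IsPathSeq G (fun m => if m ≤ i then p (i - m) else p m) k := by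
  constructor
  · intro m hm
    rcases lt_trichotomy m i with hmi | rfl | hmi
    · have h1 := (h.1 (i - (m + 1)) (by omega)).symm
      rw [show i - (m + 1) + 1 = i - m by omega] at h1
      simpa [hmi.le, show m + 1 ≤ i by omega] using h1
    · simpa using hi
    · simpa [show ¬ m ≤ i by omega, show ¬ m + 1 ≤ i by omega] using h.1 m hm
  · intro a ha b hb hab
    dsimp only at hab
    split_ifs at hab with h1 h2 h2 <;> have := h.2 _ (by omega) _ (by omega) hab <;> omega

lemma IsPathSeq.linked {p : ℕ → V} {k : ℕ} (h : IsPathSeq G p k) {a b : ℕ} (hab : a ≤ b)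
    (hb : b ≤ k) : Linked G (p '' Set.Icc a b) := by
  refine ⟨⟨p a, a, ⟨le_rfl, hab⟩, rfl⟩, ?_⟩
  intro T hT hne hc
  obtain ⟨x, hx⟩ := hne
  obtain ⟨m, ⟨hm1, hm2⟩, rfl⟩ := hT hx
  have hup : ∀ d, m + d ≤ b → p (m + d) ∈ T := by
    intro d
    induction d with
    | zero => exact fun _ => hx
    | succ d ih =>
      intro hd
      exact hc _ (ih (by omega)) _ ⟨m + (d + 1), ⟨by omega, hd⟩, rfl⟩ (h.1 (m + d) (by omega))
  have hdown : ∀ d, a + d ≤ m → p (m - d) ∈ T := by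
    intro d
    induction d with
    | zero => exact fun _ => hx
    | succ d ih =>
      intro hd
      have h1 := h.1 (m - (d + 1)) (by omega)
      rw [show m - (d + 1) + 1 = m - d by omega] at h1
      exact hc _ (ih (by omega)) _ ⟨m - (d + 1), ⟨by omega, by omega⟩, rfl⟩ h1.symm
  rintro _ ⟨i, ⟨hi1, hi2⟩, rfl⟩
  rcases le_total m i with h' | h'
  · have := hup (i - m) (by omega)
    rwa [show m + (i - m) = i by omega] at this
  · have := hdown (m - i) (by omega)
    rwa [show m - (m - i) = i by omega] at this

lemma IsPathSeq.hasTheta {p : ℕ → V} {k : ℕ} (h : IsPathSeq G p k) (x y a b c d e f : ℕ)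
    (hxy : x ≠ y) (hx : x ≤ k) (hy : y ≤ k) (hab : a ≤ b) (hcd : c ≤ d) (hef : e ≤ f)
    (hb : b < c ∨ d < a) (hd : d < e ∨ f < c) (hf : f < a ∨ b < e)
    (hbk : b ≤ k) (hdk : d ≤ k) (hfk : f ≤ k)
    (hxa : x < a ∨ b < x) (hxc : x < c ∨ d < x) (hxe : x < e ∨ f < x)
    (hya : y < a ∨ b < y) (hyc : y < c ∨ d < y) (hye : y < e ∨ f < y)
    (h1 : ∃ i, (a ≤ i ∧ i ≤ b) ∧ G.Adj (p x) (p i)) (h1' : ∃ i, (a ≤ i ∧ i ≤ b) ∧ G.Adj (p y) (p i))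
    (h2 : ∃ i, (c ≤ i ∧ i ≤ d) ∧ G.Adj (p x) (p i)) (h2' : ∃ i, (c ≤ i ∧ i ≤ d) ∧ G.Adj (p y) (p i))
    (h3 : ∃ i, (e ≤ i ∧ i ≤ f) ∧ G.Adj (p x) (p i))
    (h3' : ∃ i, (e ≤ i ∧ i ≤ f) ∧ G.Adj (p y) (p i)) : HasTheta G := by
  have key : ∀ i ≤ k, ∀ a b, b ≤ k → p i ∈ p '' Set.Icc a b → a ≤ i ∧ i ≤ b := by
    rintro i hi a b hb ⟨j, ⟨hj1, hj2⟩, hj⟩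
    obtain rfl := h.2 j (by omega) i hi hj
    exact ⟨hj1, hj2⟩
  have hdis : ∀ a b c d, b ≤ k → d ≤ k → (b < c ∨ d < a) →
      ∀ x ∈ p '' Set.Icc a b, x ∉ p '' Set.Icc c d := by
    rintro a b c d hb hd hbd _ ⟨i, ⟨hi1, hi2⟩, rfl⟩ hi
    have := key i (by omega) c d hd hi
    omega
  have hnot : ∀ i ≤ k, ∀ a b, b ≤ k → (i < a ∨ b < i) → p i ∉ p '' Set.Icc a b := by
    intro i hi a b hb hab h'
    have := key i hi a b hb h'
    omega
  have hadj : ∀ i a b, (∃ j, (a ≤ j ∧ j ≤ b) ∧ G.Adj (p i) (p j)) →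
      ∃ x ∈ p '' Set.Icc a b, G.Adj (p i) x := by
    rintro i a b ⟨j, hj, hij⟩
    exact ⟨p j, ⟨j, hj, rfl⟩, hij⟩
  exact hasTheta_of_sets (fun h' => hxy (h.2 x hx y hy h')) (h.linked hab hbk) (h.linked hcd hdk)
    (h.linked hef hfk) (hdis _ _ _ _ hbk hdk hb) (hdis _ _ _ _ hbk hfk (by omega))
    (hdis _ _ _ _ hdk hfk hd)
    ⟨hnot _ hx _ _ hbk hxa, hnot _ hx _ _ hdk hxc, hnot _ hx _ _ hfk hxe⟩
    ⟨hnot _ hy _ _ hbk hya, hnot _ hy _ _ hdk hyc, hnot _ hy _ _ hfk hye⟩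
    ⟨hadj _ _ _ h1, hadj _ _ _ h1'⟩ ⟨hadj _ _ _ h2, hadj _ _ _ h2'⟩
    ⟨hadj _ _ _ h3, hadj _ _ _ h3'⟩

lemma exists_longest_pathSeq [Fintype V] (G : SimpleGraph V) {v : V} {S : Finset V} (hv : v ∈ S) :
    ∃ k p, (IsPathSeq G p k ∧ p 0 ∈ S) ∧ ∀ q, IsPathSeq G q (k + 1) → q 0 ∉ S := by
  classical
  by_contra! hcon
  have : ∀ k, ∃ p, IsPathSeq G p k ∧ p 0 ∈ S := by
    intro k
    induction k with
    | zero => exact ⟨fun _ => v, ⟨fun i hi => by omega, fun i hi j hj _ => by omega⟩, hv⟩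
    | succ k ih =>
      obtain ⟨p, hp⟩ := ih
      exact hcon k p hp
  obtain ⟨p, hp, -⟩ := this (Fintype.card V)
  have := Fintype.card_le_of_injective (fun i : Fin (Fintype.card V + 1) => p i) (fun i j hij =>
    Fin.ext (hp.2 i (by omega) j (by omega) hij))
  simp at this

/-- A graph without theta has a vertex of degree at most two, or a pendant clique. -/
theorem exists_reducible [Fintype V] (hG : ¬ HasTheta G) {S : Finset V} (hS : S.Nonempty)
    (hE : ∀ u w, G.Adj u w → u ∈ S) :
    (∃ v ∈ S, ∃ u w, ∀ y, G.Adj v y → y = u ∨ y = w) ∨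
    ∃ a b c x, IsK4 G a b c x ∧ (∀ y, G.Adj a y → y = b ∨ y = c ∨ y = x) ∧
      (∀ y, G.Adj b y → y = a ∨ y = c ∨ y = x) ∧ ∀ y, G.Adj c y → y = a ∨ y = b ∨ y = x := by
  classical
  by_contra! hcon
  obtain ⟨hdeg, hK⟩ := hcon
  obtain ⟨v, hv⟩ := hS
  obtain ⟨k, p₀, ⟨hp₀, hp₀S⟩, hmax⟩ := exists_longest_pathSeq G hv
  have hnb : ∀ p, IsPathSeq G p k → ∀ y, G.Adj (p 0) y → ∃ i, 1 ≤ i ∧ i ≤ k ∧ y = p i := by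
    intro p hp y hy
    by_contra! h'
    refine hmax _ (hp.cons hy ?_) (by simpa using hE _ _ hy.symm)
    intro i hi
    rcases i with _ | i
    · exact hy.ne'
    · exact h' _ (by omega) hi
  have hex : ∃ i, 1 ≤ i ∧ ∃ p, IsPathSeq G p k ∧ p 0 ∈ S ∧ i + 1 ≤ k ∧ G.Adj (p 0) (p (i + 1)) := by
    obtain ⟨y, hy, hy1, -⟩ := hdeg _ hp₀S (p₀ 1) (p₀ 1)
    obtain ⟨i, hi1, hik, rfl⟩ := hnb p₀ hp₀ y hy
    obtain ⟨i, rfl⟩ : ∃ m, i = m + 1 := ⟨i - 1, by omega⟩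
    refine ⟨i, ?_, p₀, hp₀, hp₀S, hik, hy⟩
    rcases i with _ | i
    · exact absurd rfl hy1
    · omega
  obtain ⟨hi1, p, hp, hpS, hik, hpi⟩ := Nat.find_spec hex
  have hmin : ∀ q, IsPathSeq G q k → q 0 ∈ S → ∀ m, 2 ≤ m → m ≤ k → G.Adj (q 0) (q m) →
      Nat.find hex + 1 ≤ m := by
    intro q hq hqS m hm hmk hqm
    have := Nat.find_min' hex (m := m - 1) ⟨by omega, q, hq, hqS, by omega, by
      rwa [show m - 1 + 1 = m by omega]⟩
    omega
  set i := Nat.find hex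
  clear_value i
  have h01 : G.Adj (p 0) (p 1) := hp.1 0 (by omega)
  have hsucc : ∀ m < k, G.Adj (p m) (p (m + 1)) := hp.1
  have hpred : ∀ m, 1 ≤ m → m ≤ k → G.Adj (p m) (p (m - 1)) := by
    intro m h1 h2
    have := hp.1 (m - 1) (by omega)
    rw [show m - 1 + 1 = m by omega] at this
    exact this.symm
  have hS' : ∀ m ≤ k, p m ∈ S := by
    intro m hm
    rcases m with _ | m
    · exact hpS
    · exact hE _ _ (hpred (m + 1) (by omega) hm)
  have hr := hp.rotate hik hpi
  have h0nb : ∀ y, G.Adj (p 0) y → y ≠ p 1 → y ≠ p (i + 1) → ∃ j, i + 1 < j ∧ j ≤ k ∧ y = p j := by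
    intro y hy hy1 hyi
    obtain ⟨j, hj1, hjk, rfl⟩ := hnb p hp y hy
    refine ⟨j, ?_, hjk, rfl⟩
    have hj1' : j ≠ 1 := fun h => hy1 (by rw [h])
    have hji : j ≠ i + 1 := fun h => hyi (by rw [h])
    have := hmin p hp hpS j (by omega) hjk hy
    omega
  have hinb : ∀ y, G.Adj (p i) y → y ≠ p (i - 1) → y ≠ p (i + 1) →
      ∃ q, i + 1 < q ∧ q ≤ k ∧ y = p q := by
    intro y hy hy1 hyi
    obtain ⟨q, hq1, hqk, hyq⟩ := hnb _ hr y (by simpa using hy)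
    have hq1' : q ≠ 1 := by rintro rfl; simp [hi1] at hyq; exact hy1 hyq
    have := hmin _ hr (by simpa using hS' i (by omega)) q (by omega) hqk (by rw [← hyq]; simpa using hy)
    rw [if_neg (by omega)] at hyq
    exact ⟨q, lt_of_le_of_ne this (fun h => hyi (by rw [hyq, h])), hqk, hyq⟩
  have main : ∀ j q, i + 1 < j → j ≤ k → i + 1 < q → q ≤ k → G.Adj (p 0) (p j) →
      G.Adj (p i) (p q) → i = 1 ∧ j = 3 ∧ q = 3 := by
    intro j q hj hjk hq hqk h0j hiq
    by_contra hne
    apply hG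
    rcases lt_trichotomy j q with hjq | rfl | hjq
    · exact hp.hasTheta i j (j + 1) q 0 (i - 1) (i + 1) (j - 1) (by omega) (by omega) (by omega)
        (by omega) (by omega) (by omega) (by omega) (by omega) (by omega) (by omega) (by omega)
        (by omega) (by omega) (by omega) (by omega) (by omega) (by omega) (by omega)
        ⟨q, by omega, hiq⟩ ⟨j + 1, by omega, hsucc j (by omega)⟩
        ⟨i - 1, by omega, hpred i (by omega) (by omega)⟩ ⟨0, by omega, h0j.symm⟩
        ⟨i + 1, by omega, hsucc i (by omega)⟩ ⟨j - 1, by omega, hpred j (by omega) (by omega)⟩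
    · by_cases hi2 : i = 1
      · subst hi2
        exact hp.hasTheta 2 j 3 (j - 1) 0 0 1 1 (by omega) (by omega) (by omega)
          (by omega) (by omega) (by omega) (by omega) (by omega) (by omega) (by omega) (by omega)
          (by omega) (by omega) (by omega) (by omega) (by omega) (by omega) (by omega)
          ⟨3, by omega, hsucc 2 (by omega)⟩ ⟨j - 1, by omega, hpred j (by omega) (by omega)⟩
          ⟨0, by omega, hpi.symm⟩ ⟨0, by omega, h0j.symm⟩
          ⟨1, by omega, hpred 2 (by omega) (by omega)⟩ ⟨1, by omega, hiq.symm⟩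
      · exact hp.hasTheta 0 i 1 (i - 1) (i + 1) (i + 1) j j (by omega) (by omega) (by omega)
          (by omega) (by omega) (by omega) (by omega) (by omega) (by omega) (by omega) (by omega)
          (by omega) (by omega) (by omega) (by omega) (by omega) (by omega) (by omega)
          ⟨1, by omega, h01⟩ ⟨i - 1, by omega, hpred i (by omega) (by omega)⟩
          ⟨i + 1, by omega, hpi⟩ ⟨i + 1, by omega, hsucc i (by omega)⟩
          ⟨j, by omega, h0j⟩ ⟨j, by omega, hiq⟩
    · exact hp.hasTheta 0 q (q + 1) j 1 i (i + 1) (q - 1) (by omega) (by omega) (by omega)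
        (by omega) (by omega) (by omega) (by omega) (by omega) (by omega) (by omega) (by omega)
        (by omega) (by omega) (by omega) (by omega) (by omega) (by omega) (by omega)
        ⟨j, by omega, h0j⟩ ⟨q + 1, by omega, hsucc q (by omega)⟩
        ⟨1, by omega, h01⟩ ⟨i, by omega, hiq.symm⟩
        ⟨i + 1, by omega, hpi⟩ ⟨q - 1, by omega, hpred q (by omega) (by omega)⟩
  obtain ⟨y, hy, hy1, hy2⟩ := hdeg _ hpS (p 1) (p (i + 1))
  obtain ⟨j, hj, hjk, rfl⟩ := h0nb y hy hy1 hy2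
  obtain ⟨z, hz, hz1, hz2⟩ := hdeg _ (hS' i (by omega)) (p (i - 1)) (p (i + 1))
  obtain ⟨q, hq, hqk, rfl⟩ := hinb z hz hz1 hz2
  obtain ⟨rfl, rfl, rfl⟩ := main j q hj hjk hq hqk hy hz
  have h03 : IsPathSeq G _ k := hp.rotate (i := 2) hjk hy
  obtain ⟨y, hy', hy0, hy1, hy3⟩ := hK (p 0) (p 1) (p 2) (p 3)
    ⟨h01, hpi, hy, hsucc 1 (by omega), hz, hsucc 2 (by omega)⟩
    (by
      intro y hy'
      by_contra! h'
      obtain ⟨j, hj, hjk, rfl⟩ := h0nb y hy' h'.1 h'.2.1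
      exact h'.2.2 (by rw [(main j 3 hj hjk (by omega) hqk hy' hz).2.1]))
    (by
      intro y hy'
      by_contra! h'
      obtain ⟨q, hq, hqk, rfl⟩ := hinb y hy' h'.1 h'.2.1
      exact h'.2.2 (by rw [(main 3 q (by omega) hjk hq hqk hy hy').2.2]))
  obtain ⟨m, hm1, hmk, rfl⟩ := hnb _ h03 y (by simpa using hy')
  have hm4 : 4 ≤ m := by
    by_contra h'
    have : m = 1 ∨ m = 2 ∨ m = 3 := by omega
    rcases this with rfl | rfl | rfl <;> simp at hy0 hy1 hy3
  rw [if_neg (by omega)] at hy'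
  exact hG (hp.hasTheta 2 3 0 0 1 1 4 m (by omega) (by omega) (by omega)
        (by omega) (by omega) (by omega) (by omega) (by omega) (by omega) (by omega) (by omega)
        (by omega) (by omega) (by omega) (by omega) (by omega) (by omega) (by omega)
        ⟨0, by omega, hpi.symm⟩ ⟨0, by omega, hy.symm⟩
        ⟨1, by omega, hpred 2 (by omega) (by omega)⟩ ⟨1, by omega, hz.symm⟩
        ⟨m, by omega, hy'⟩ ⟨4, by omega, hsucc 3 (by omega)⟩)

end Path

section Induction
variable {V : Type}

/-- Isolate the vertices in `D`. -/
def isolate (G : SimpleGraph V) (D : Finset V) : SimpleGraph V where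
  Adj u w := G.Adj u w ∧ u ∉ D ∧ w ∉ D
  symm := ⟨fun _ _ h => ⟨h.1.symm, h.2.2, h.2.1⟩⟩
  loopless := ⟨fun _ h => h.1.ne rfl⟩

lemma isolate_adj {G : SimpleGraph V} {D : Finset V} {u w : V} :
    (isolate G D).Adj u w ↔ G.Adj u w ∧ u ∉ D ∧ w ∉ D := Iff.rfl

lemma isolate_le (G : SimpleGraph V) (D : Finset V) : isolate G D ≤ G := fun _ _ h => h.1

lemma adj_of_ear_adj {G : SimpleGraph V} {D : Finset V} {u w x y : V}
    (h : (isolate G D ⊔ edge u w).Adj x y) :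
    (G.Adj x y ∧ x ∉ D ∧ y ∉ D) ∨ (x = u ∧ y = w) ∨ (x = w ∧ y = u) := by
  rw [sup_adj, isolate_adj, edge_adj] at h
  tauto

lemma IsK4.mono {G G' : SimpleGraph V} (hG : G ≤ G') {u w x y : V} (h : IsK4 G u w x y) :
    IsK4 G' u w x y :=
  ⟨hG h.1, hG h.2.1, hG h.2.2.1, hG h.2.2.2.1, hG h.2.2.2.2.1, hG h.2.2.2.2.2⟩

/-- Induction on the structure of graphs without theta. -/
theorem theta_free_induction [Fintype V] [DecidableEq V] {P : SimpleGraph V → Finset V → Prop}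
    (empty : ∀ G, (∀ u w, ¬ G.Adj u w) → P G ∅)
    (isolated : ∀ (G : SimpleGraph V) S v, v ∉ S → (∀ y, ¬ G.Adj v y) → P (isolate G {v}) S →
      P G (S ∪ {v}))
    (pendant : ∀ (G : SimpleGraph V) S v u, v ∉ S → u ∈ S → (∀ y, G.Adj v y → y = u) →
      P (isolate G {v}) S → P G (S ∪ {v}))
    (ear : ∀ (G : SimpleGraph V) S v u w, v ∉ S → u ∈ S → w ∈ S → u ≠ w →
      (∀ y, G.Adj v y → y = u ∨ y = w) → (∀ x y, ¬ IsK4 (isolate G {v} ⊔ edge u w) u w x y) →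
      P (isolate G {v} ⊔ edge u w) S → P G (S ∪ {v}))
    (clique : ∀ (G : SimpleGraph V) S a b c x, a ∉ S → b ∉ S → c ∉ S → x ∈ S → IsK4 G a b c x →
      (∀ v ∈ ({a, b, c} : Finset V), ∀ y, G.Adj v y → y ∈ ({a, b, c, x} : Finset V)) →
      P (isolate G {a, b, c}) S → P G (S ∪ {a, b, c}))
    (G : SimpleGraph V) (S : Finset V) (hE : ∀ u w, G.Adj u w → u ∈ S) (hG : ¬ HasTheta G) :
    P G S := by
  induction hn : S.card using Nat.strong_induction_on generalizing G S with
  | _ n ih =>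
  subst hn
  rcases S.eq_empty_or_nonempty with rfl | hS
  · exact empty G fun u w h => absurd (hE u w h) (by simp)
  have hE' : ∀ u w, G.Adj u w → w ∈ S := fun u w h => hE w u h.symm
  have step : ∀ D : Finset V, D.Nonempty → D ⊆ S → P (isolate G D) (S \ D) := by
    intro D hD hDS
    refine ih _ ?_ (isolate G D) (S \ D) ?_ (fun h => hG (h.mono (isolate_le G D))) rfl
    · exact Finset.card_lt_card (Finset.sdiff_ssubset hDS hD)
    · exact fun u w h => Finset.mem_sdiff.2 ⟨hE u w h.1, h.2.1⟩
  rcases exists_reducible hG hS hE with ⟨v, hv, u, w, hN⟩ | ⟨a, b, c, x, hK, ha, hb, hc⟩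
  · have hv' : v ∉ S \ {v} := by simp
    have hSv : S \ {v} ∪ {v} = S := Finset.sdiff_union_of_subset (by simpa using hv)
    have hmem : ∀ y, G.Adj v y → y ∈ S \ {v} := fun y hy =>
      Finset.mem_sdiff.2 ⟨hE' v y hy, by simpa using hy.ne'⟩
    have hP := step {v} (by simp) (by simpa using hv)
    rw [← hSv]
    have one : ∀ u, (∀ y, G.Adj v y → y = u) → P G (S \ {v} ∪ {v}) := by
      intro u hN
      by_cases hu : G.Adj v u
      · exact pendant G _ v u hv' (hmem u hu) hN hP
      · exact isolated G _ v hv' (fun y hy => hu (hN y hy ▸ hy)) hP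
    by_cases hu : G.Adj v u
    swap
    · exact one w fun y hy => (hN y hy).resolve_left fun h => hu (h ▸ hy)
    by_cases hw : G.Adj v w
    swap
    · exact one u fun y hy => (hN y hy).resolve_right fun h => hw (h ▸ hy)
    by_cases huw : u = w
    · subst huw; exact one u fun y hy => by simpa using hN y hy
    refine ear G _ v u w hv' (hmem u hu) (hmem w hw) huw hN ?_ ?_
    · intro x y hK
      have hadj : ∀ {x y}, (isolate G {v} ⊔ edge u w).Adj x y → (x ≠ u ∨ y ≠ w) →
          (x ≠ w ∨ y ≠ u) → G.Adj x y ∧ x ≠ v ∧ y ≠ v := by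
        intro x y hxy h1 h2
        have := adj_of_ear_adj hxy
        simp only [Finset.mem_singleton] at this
        tauto
      obtain ⟨-, hux, huy, hwx, hwy, hxy⟩ := hK
      have e1 := hadj hux (Or.inr hwx.ne') (Or.inr hux.ne')
      have e2 := hadj huy (Or.inr hwy.ne') (Or.inr huy.ne')
      have e3 := hadj hwx (Or.inr hwx.ne') (Or.inr hux.ne')
      have e4 := hadj hwy (Or.inr hwy.ne') (Or.inr huy.ne')
      exact hG (hasTheta_of_common_neighbours huw e1.2.2.symm e2.2.2.symm hxy.ne hu.symm e1.1 e2.1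
        hw.symm e3.1 e4.1)
    · refine ih _ ?_ _ _ ?_ ?_ rfl
      · exact Finset.card_lt_card (Finset.sdiff_ssubset (by simpa using hv) (by simp))
      · intro x y hxy
        rcases adj_of_ear_adj hxy with h | ⟨rfl, rfl⟩ | ⟨rfl, rfl⟩
        · exact Finset.mem_sdiff.2 ⟨hE x y h.1, h.2.1⟩
        · exact hmem _ hu
        · exact hmem _ hw
      · refine fun h => hG (h.of_subdivision hu hw ?_ fun x y hxy => ?_)
        · intro y hy
          rcases adj_of_ear_adj hy with h | ⟨rfl, rfl⟩ | ⟨rfl, rfl⟩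
          · exact h.2.1 (by simp)
          · exact hu.ne rfl
          · exact hw.ne rfl
        · exact (adj_of_ear_adj hxy).imp_left fun h => h.1
  · have hD : ({a, b, c} : Finset V) ⊆ S := by
      intro y hy
      simp only [Finset.mem_insert, Finset.mem_singleton] at hy
      rcases hy with rfl | rfl | rfl
      · exact hE _ _ hK.1
      · exact hE' _ _ hK.1
      · exact hE' _ _ hK.2.1
    have hP := step {a, b, c} (by simp) hD
    rw [← Finset.sdiff_union_of_subset hD]
    refine clique G _ a b c x (by simp) (by simp) (by simp) ?_ hK ?_ hP
    · simp only [Finset.mem_sdiff, Finset.mem_insert, Finset.mem_singleton]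
      exact ⟨hE' _ _ hK.2.2.1, by simp [hK.2.2.1.ne', hK.2.2.2.2.1.ne', hK.2.2.2.2.2.ne']⟩
    · intro v hv y hy
      simp only [Finset.mem_insert, Finset.mem_singleton] at hv ⊢
      rcases hv with rfl | rfl | rfl
      · have := ha y hy; tauto
      · have := hb y hy; tauto
      · have := hc y hy; tauto

/-- `u w` is an edge contained in no clique on four vertices. -/
def IsThinEdge (G : SimpleGraph V) (u w : V) : Prop := G.Adj u w ∧ ∀ x y, ¬ IsK4 G u w x y

lemma IsThinEdge.symm {G : SimpleGraph V} {u w : V} (h : IsThinEdge G u w) : IsThinEdge G w u :=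
  ⟨h.1.symm, fun x y hK => h.2 x y
    ⟨hK.1.symm, hK.2.2.2.1, hK.2.2.2.2.1, hK.2.1, hK.2.2.1, hK.2.2.2.2.2⟩⟩

lemma IsThinEdge.isolate {G : SimpleGraph V} {D : Finset V} {u w : V} (h : IsThinEdge G u w)
    (hu : u ∉ D) (hw : w ∉ D) : IsThinEdge (isolate G D) u w :=
  ⟨⟨h.1, hu, hw⟩, fun x y hK => h.2 x y (hK.mono (isolate_le G D))⟩

lemma IsThinEdge.ear {G : SimpleGraph V} {D : Finset V} {u w p q : V} (h : IsThinEdge G p q)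
    (hp : p ∉ D) (hq : q ∉ D) (hK : ∀ x y, ¬ IsK4 (_root_.isolate G D ⊔ edge u w) u w x y) :
    IsThinEdge (_root_.isolate G D ⊔ edge u w) p q := by
  refine ⟨Or.inl ⟨h.1, hp, hq⟩, fun x y hK' => ?_⟩
  have key : ∀ x' y', (_root_.isolate G D ⊔ edge u w).Adj x' y' → ¬ G.Adj x' y' →
      (x' = u ∧ y' = w) ∨ (x' = w ∧ y' = u) := by
    intro x' y' h1 h2
    have := adj_of_ear_adj h1
    tauto
  refine h.2 x y ?_
  obtain ⟨h1, h2, h3, h4, h5, h6⟩ := hK'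
  by_contra hcon
  have : ¬ G.Adj p x ∨ ¬ G.Adj p y ∨ ¬ G.Adj q x ∨ ¬ G.Adj q y ∨ ¬ G.Adj x y := by
    have := h.1
    unfold IsK4 at hcon
    tauto
  rcases this with h' | h' | h' | h' | h'
  · rcases key _ _ h2 h' with ⟨rfl, rfl⟩ | ⟨rfl, rfl⟩
    · exact hK q y ⟨h2, h1, h3, h4.symm, h6, h5⟩
    · exact hK q y ⟨h2.symm, h4.symm, h6, h1, h3, h5⟩
  · rcases key _ _ h3 h' with ⟨rfl, rfl⟩ | ⟨rfl, rfl⟩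
    · exact hK q x ⟨h3, h1, h2, h5.symm, h6.symm, h4⟩
    · exact hK q x ⟨h3.symm, h5.symm, h6.symm, h1, h2, h4⟩
  · rcases key _ _ h4 h' with ⟨rfl, rfl⟩ | ⟨rfl, rfl⟩
    · exact hK p y ⟨h4, h1.symm, h5, h2.symm, h6, h3⟩
    · exact hK p y ⟨h4.symm, h2.symm, h6, h1.symm, h5, h3⟩
  · rcases key _ _ h5 h' with ⟨rfl, rfl⟩ | ⟨rfl, rfl⟩
    · exact hK p x ⟨h5, h1.symm, h4, h3.symm, h6.symm, h2⟩
    · exact hK p x ⟨h5.symm, h3.symm, h6.symm, h1.symm, h4, h2⟩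
  · rcases key _ _ h6 h' with ⟨rfl, rfl⟩ | ⟨rfl, rfl⟩
    · exact hK p q ⟨h6, h2.symm, h4.symm, h3.symm, h5.symm, h1⟩
    · exact hK p q ⟨h6.symm, h3.symm, h5.symm, h2.symm, h4.symm, h1⟩

theorem stageOK_of_theta_free [Fintype V] [DecidableEq V] [Nonempty V] {R t : ℕ}
    (hs : StageParams R t) (G : SimpleGraph V) (S : Finset V) (hE : ∀ u w, G.Adj u w → u ∈ S)
    (hG : ¬ HasTheta G) : StageOK R t G (IsThinEdge G) S := by
  refine theta_free_induction (P := fun G S => StageOK R t G (IsThinEdge G) S)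
    ?_ ?_ ?_ ?_ ?_ G S hE hG
  · intro G _ α _
    exact ⟨fun v => v, [], by constructor <;> simp⟩
  · intro G S v hv hN hP
    refine hP.attach_isolated hs hv ?_ ?_ (fun _ _ h => h.symm) (fun _ _ h => h.1)
      fun y _ => hN y
    · intro u hu w hw h
      refine ⟨h, ?_, ?_⟩ <;> rw [Finset.mem_singleton] <;> rintro rfl <;> exact hv ‹_›
    · intro u hu w hw h
      refine h.isolate ?_ ?_ <;> rw [Finset.mem_singleton] <;> rintro rfl <;> exact hv ‹_›
  · intro G S v u hv hu hN hP
    refine hP.attach_pendant hs hv hu ?_ ?_ (fun _ _ h => h.symm) (fun _ _ h => h.1)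
      fun y _ => hN y
    · intro u hu w hw h
      refine ⟨h, ?_, ?_⟩ <;> rw [Finset.mem_singleton] <;> rintro rfl <;> exact hv ‹_›
    · intro u hu w hw h
      refine h.isolate ?_ ?_ <;> rw [Finset.mem_singleton] <;> rintro rfl <;> exact hv ‹_›
  · intro G S v u w hv hu hw huw hN hK hP
    have hadj : (isolate G {v} ⊔ edge u w).Adj u w := by
      rw [sup_adj, edge_adj]; exact Or.inr ⟨Or.inl ⟨rfl, rfl⟩, huw⟩
    refine hP.attach_ear hs hv hu hw ⟨hadj, hK⟩ hadj ?_ ?_ (fun _ _ h => h.symm)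
      (fun _ _ h => h.1) fun y _ => hN y
    · intro u hu w hw h
      refine Or.inl ⟨h, ?_, ?_⟩ <;> rw [Finset.mem_singleton] <;> rintro rfl <;> exact hv ‹_›
    · intro u hu w hw h
      refine h.ear ?_ ?_ hK <;> rw [Finset.mem_singleton] <;> rintro rfl <;> exact hv ‹_›
  · intro G S a b c x ha hb hc hx hK hN hP
    have hD : ∀ v ∈ S, v ∉ ({a, b, c} : Finset V) := by
      intro v hv h
      simp only [Finset.mem_insert, Finset.mem_singleton] at h
      rcases h with rfl | rfl | rfl <;> exact absurd hv ‹_›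
    refine hP.attach_clique hs hx (Finset.disjoint_left.2 fun v hv hvS => hD v hvS hv)
      Finset.card_le_three ?_ ?_ (fun _ _ h => h.symm) (fun _ _ h => h.1) ?_ ?_
    · exact fun u hu w hw h => ⟨h, hD u hu, hD w hw⟩
    · exact fun u hu w hw h => h.isolate (hD u hu) (hD w hw)
    · intro v hv y hy hvy
      have h1 := hN v hv y hvy
      have h2 := hD y hy
      simp only [Finset.mem_insert, Finset.mem_singleton] at h1 h2
      tauto
    · rintro v hv y ⟨hvy, hno⟩
      obtain ⟨h1, h2, h3, h4, h5, h6⟩ := hK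
      have h7 := hN v hv y hvy
      simp only [Finset.mem_insert, Finset.mem_singleton] at hv h7
      have s := h1.symm
      have s2 := h2.symm
      have s3 := h3.symm
      have s4 := h4.symm
      have s5 := h5.symm
      have s6 := h6.symm
      rcases hv with rfl | rfl | rfl <;> rcases h7 with rfl | rfl | rfl | rfl
      · exact hvy.ne rfl
      · exact hno c x ⟨h1, h2, h3, h4, h5, h6⟩
      · exact hno b x ⟨h2, h1, h3, s4, h6, h5⟩
      · exact hno b c ⟨h3, h1, h2, s5, s6, h4⟩
      · exact hno c x ⟨s, h4, h5, h2, h3, h6⟩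
      · exact hvy.ne rfl
      · exact hno a x ⟨h4, s, h5, s2, h6, h3⟩
      · exact hno a c ⟨h5, s, h4, s3, s6, h2⟩
      · exact hno b x ⟨s2, s4, h6, h1, h3, h5⟩
      · exact hno a x ⟨s4, s2, h6, s, h5, h3⟩
      · exact hvy.ne rfl
      · exact hno a b ⟨h6, s2, s4, s3, s5, h1⟩

end Induction

section Final
variable {V : Type} [DecidableEq V]

/-- Graphs on `W` built by adding vertices of degree at most one and pendant triangles. -/
inductive TriangleTree (G : SimpleGraph V) : Finset V → Prop
  | empty : TriangleTree G ∅
  | add {W : Finset V} (v u : V) (hW : TriangleTree G W) (hv : v ∉ W)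
      (hN : ∀ w ∈ W, G.Adj v w → w = u) : TriangleTree G (insert v W)
  | triangle {W : Finset V} (v w x : V) (hW : TriangleTree G W) (hv : v ∉ W) (hw : w ∉ W)
      (hx : x ∈ W) (hvw : G.Adj v w) (hvx : G.Adj v x) (hwx : G.Adj w x)
      (hNv : ∀ y ∈ W, G.Adj v y → y = x) (hNw : ∀ y ∈ W, G.Adj w y → y = x) :
      TriangleTree G (insert w (insert v W))

lemma TriangleTree.mono {G H : SimpleGraph V} {W : Finset V} (h : TriangleTree G W)
    (hH : ∀ u ∈ W, ∀ w ∈ W, H.Adj u w → G.Adj u w) : TriangleTree H W := by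
  induction h with
  | empty => exact .empty
  | @add W v u hW hv hN ih =>
    refine .add v u (ih fun x hx y hy => hH x (by simp [hx]) y (by simp [hy])) hv ?_
    exact fun w hw hvw => hN w hw (hH v (by simp) w (by simp [hw]) hvw)
  | @triangle W v w x hW hv hw hx hvw hvx hwx hNv hNw ih =>
    have ih' := ih fun x hx y hy => hH x (by simp [hx]) y (by simp [hy])
    have hNv' : ∀ y ∈ W, H.Adj v y → y = x :=
      fun y hy h => hNv y hy (hH v (by simp) y (by simp [hy]) h)
    have hNw' : ∀ y ∈ W, H.Adj w y → y = x :=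
      fun y hy h => hNw y hy (hH w (by simp) y (by simp [hy]) h)
    have hv' : v ∉ insert w W := by simp [hv, hvw.ne]
    have hw' : w ∉ insert v W := by simp [hw, hvw.ne']
    by_cases e1 : H.Adj v w
    swap
    · refine .add w x (.add v x ih' hv hNv') hw' fun y hy h => ?_
      rcases Finset.mem_insert.1 hy with rfl | hy
      · exact absurd h.symm e1
      · exact hNw' y hy h
    by_cases e2 : H.Adj v x
    swap
    · rw [Finset.insert_comm]
      refine .add v w (.add w x ih' hw hNw') hv' fun y hy h => ?_
      rcases Finset.mem_insert.1 hy with rfl | hy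
      · rfl
      · exact absurd (hNv' y hy h ▸ h) e2
    by_cases e3 : H.Adj w x
    swap
    · refine .add w v (.add v x ih' hv hNv') hw' fun y hy h => ?_
      rcases Finset.mem_insert.1 hy with rfl | hy
      · rfl
      · exact absurd (hNw' y hy h ▸ h) e3
    exact .triangle v w x ih' hv hw hx e1 e2 e3 hNv' hNw'

theorem exists_independent_triangleTree [Fintype V] (G : SimpleGraph V) (S : Finset V)
    (hE : ∀ u w, G.Adj u w → u ∈ S) (hG : ¬ HasTheta G) :
    ∃ I ⊆ S, (∀ u ∈ I, ∀ w ∈ I, ¬ G.Adj u w) ∧ TriangleTree G (S \ I) := by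
  refine theta_free_induction
    (P := fun G S => ∃ I ⊆ S, (∀ u ∈ I, ∀ w ∈ I, ¬ G.Adj u w) ∧ TriangleTree G (S \ I))
    ?_ ?_ ?_ ?_ ?_ G S hE hG
  · exact fun G _ => ⟨∅, by simp, by simp, by simpa using TriangleTree.empty⟩
  all_goals clear hE hG G S
  all_goals intro G S
  · rintro v hv hN ⟨I, hIS, hI, hT⟩
    have hvI : v ∉ I := fun h => hv (hIS h)
    refine ⟨I, hIS.trans Finset.subset_union_left, fun u hu w hw h => hI u hu w hw ⟨h, ?_, ?_⟩, ?_⟩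
    · simpa using ne_of_mem_of_not_mem hu hvI
    · simpa using ne_of_mem_of_not_mem hw hvI
    · rw [Finset.union_comm, ← Finset.insert_eq, Finset.insert_sdiff_of_notMem _ hvI]
      refine .add v v (hT.mono fun u hu w hw h => ⟨h, ?_, ?_⟩) (by simp [hv])
        fun w _ h => absurd h (hN w)
      · simpa using ne_of_mem_of_not_mem (Finset.sdiff_subset hu) hv
      · simpa using ne_of_mem_of_not_mem (Finset.sdiff_subset hw) hv
  · rintro v u hv hu hN ⟨I, hIS, hI, hT⟩
    have hvI : v ∉ I := fun h => hv (hIS h)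
    refine ⟨I, hIS.trans Finset.subset_union_left, fun u hu w hw h => hI u hu w hw ⟨h, ?_, ?_⟩, ?_⟩
    · simpa using ne_of_mem_of_not_mem hu hvI
    · simpa using ne_of_mem_of_not_mem hw hvI
    · rw [Finset.union_comm, ← Finset.insert_eq, Finset.insert_sdiff_of_notMem _ hvI]
      refine .add v u (hT.mono fun u hu w hw h => ⟨h, ?_, ?_⟩) (by simp [hv])
        fun w _ h => hN w h
      · simpa using ne_of_mem_of_not_mem (Finset.sdiff_subset hu) hv
      · simpa using ne_of_mem_of_not_mem (Finset.sdiff_subset hw) hv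
  · rintro v u w hv hu hw huw hN - ⟨I, hIS, hI, hT⟩
    have hvI : v ∉ I := fun h => hv (hIS h)
    have hadj : (isolate G {v} ⊔ edge u w).Adj u w := by
      rw [sup_adj, edge_adj]; exact Or.inr ⟨Or.inl ⟨rfl, rfl⟩, huw⟩
    have hI' : ∀ u ∈ I, ∀ w ∈ I, ¬ G.Adj u w := fun u hu w hw h => hI u hu w hw (Or.inl ⟨h,
      by simpa using ne_of_mem_of_not_mem hu hvI, by simpa using ne_of_mem_of_not_mem hw hvI⟩)
    have hT' : TriangleTree G (S \ I) := hT.mono fun u hu w hw h => Or.inl ⟨h,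
      by simpa using ne_of_mem_of_not_mem (Finset.sdiff_subset hu) hv,
      by simpa using ne_of_mem_of_not_mem (Finset.sdiff_subset hw) hv⟩
    rw [Finset.union_comm, ← Finset.insert_eq]
    by_cases h : u ∉ I ∧ w ∉ I
    · refine ⟨insert v I, Finset.insert_subset_insert _ hIS, ?_, ?_⟩
      · have hvN : ∀ y ∈ I, ¬ G.Adj v y := by
          rintro y hy hvy
          rcases hN y hvy with rfl | rfl
          · exact h.1 hy
          · exact h.2 hy
        intro x hx y hy hxy
        rcases Finset.mem_insert.1 hx with rfl | hx' <;> rcases Finset.mem_insert.1 hy with rfl | hy'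
        · exact hxy.ne rfl
        · exact hvN y hy' hxy
        · exact hvN x hx' hxy.symm
        · exact hI' x hx' y hy' hxy
      · rwa [Finset.insert_sdiff_insert, Finset.sdiff_insert_of_notMem hv]
    · refine ⟨I, hIS.trans (Finset.subset_insert _ _), hI', ?_⟩
      rw [Finset.insert_sdiff_of_notMem _ hvI]
      by_cases huI : u ∈ I
      · refine .add v w hT' (by simp [hv]) fun y hy hvy => (hN y hvy).resolve_left ?_
        rintro rfl; exact (Finset.mem_sdiff.1 hy).2 huI
      · refine .add v u hT' (by simp [hv]) fun y hy hvy => (hN y hvy).resolve_right ?_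
        rintro rfl; exact h ⟨huI, (Finset.mem_sdiff.1 hy).2⟩
  · rintro a b c x ha hb hc hx ⟨hab, hac, hax, hbc, hbx, hcx⟩ hN ⟨I, hIS, hI, hT⟩
    have hD : ∀ v ∈ S, v ∉ ({a, b, c} : Finset V) := by
      intro v hv h
      simp only [Finset.mem_insert, Finset.mem_singleton] at h
      rcases h with rfl | rfl | rfl <;> exact absurd hv ‹_›
    have hI' : ∀ u ∈ I, ∀ w ∈ I, ¬ G.Adj u w :=
      fun u hu w hw h => hI u hu w hw ⟨h, hD u (hIS hu), hD w (hIS hw)⟩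
    have hT' : TriangleTree G (S \ I) := hT.mono fun u hu w hw h =>
      ⟨h, hD u (Finset.sdiff_subset hu), hD w (Finset.sdiff_subset hw)⟩
    have hNx : ∀ v ∈ ({a, b, c} : Finset V), ∀ y ∈ S, G.Adj v y → y = x := by
      intro v hv y hy hvy
      have h1 := hN v hv y hvy
      have h2 := hD y hy
      simp only [Finset.mem_insert, Finset.mem_singleton] at h1 h2
      tauto
    have haI : a ∉ I := fun h => ha (hIS h)
    have hbI : b ∉ I := fun h => hb (hIS h)
    have hcI : c ∉ I := fun h => hc (hIS h)
    have hU : S ∪ {a, b, c} = insert c (insert b (insert a S)) := by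
      ext y; simp only [Finset.mem_union, Finset.mem_insert, Finset.mem_singleton]; tauto
    rw [hU]
    by_cases hxI : x ∈ I
    · have hno : ∀ v ∈ ({a, b, c} : Finset V), ∀ y ∈ S \ I, ¬ G.Adj v y := by
        intro v hv y hy hvy
        have := hNx v hv y (Finset.sdiff_subset hy) hvy
        rw [this] at hy
        exact (Finset.mem_sdiff.1 hy).2 hxI
      refine ⟨I, hIS.trans fun y hy => by simp [hy], hI', ?_⟩
      rw [Finset.insert_sdiff_of_notMem _ hcI, Finset.insert_sdiff_of_notMem _ hbI,
        Finset.insert_sdiff_of_notMem _ haI]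
      refine .triangle b c a (.add a a hT' (by simp [ha]) ?_) ?_ ?_ (by simp) hbc hab.symm hac.symm
        ?_ ?_
      · exact fun y hy h => absurd h (hno a (by simp) y hy)
      · simp [hb, hab.ne']
      · simp [hc, hac.ne']
      · intro y hy h
        exact (Finset.mem_insert.1 hy).resolve_right fun hy => hno b (by simp) y hy h
      · intro y hy h
        exact (Finset.mem_insert.1 hy).resolve_right fun hy => hno c (by simp) y hy h
    · refine ⟨insert c I, Finset.insert_subset_insert _ (hIS.trans fun y hy => by simp [hy]), ?_, ?_⟩
      · have hcN : ∀ y ∈ I, ¬ G.Adj c y :=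
          fun y hy h => hxI (hNx c (by simp) y (hIS hy) h ▸ hy)
        intro u hu w hw h
        rcases Finset.mem_insert.1 hu with rfl | hu' <;> rcases Finset.mem_insert.1 hw with rfl | hw'
        · exact h.ne rfl
        · exact hcN w hw' h
        · exact hcN u hu' h.symm
        · exact hI' u hu' w hw' h
      · rw [Finset.insert_sdiff_insert, Finset.sdiff_insert_of_notMem (by simp [hc, hac.ne', hbc.ne']),
          Finset.insert_sdiff_of_notMem _ hbI, Finset.insert_sdiff_of_notMem _ haI]
        exact .triangle a b x hT' (by simp [ha]) (by simp [hb]) (by simp [hx, hxI]) hab hax hbx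
          (fun y hy => hNx a (by simp) y (Finset.sdiff_subset hy))
          (fun y hy => hNx b (by simp) y (Finset.sdiff_subset hy))

/-- The events `L` on `W` take the coloring `a` to `b` and stay proper on `W`. -/
structure MoveState (G : SimpleGraph V) (a b : V → ℕ) (W : Finset V) (L : List (V × ℕ)) : Prop where
  mem : ∀ e ∈ L, e.1 ∈ W
  moves : ∀ v ∈ W, Moves (a v) (b v) (own v L)
  pair : ∀ u ∈ W, ∀ w ∈ W, G.Adj u w → pairOK (a u) (a w) (pr u w L)

lemma MoveState.insert {G : SimpleGraph V} {a b : V → ℕ} {W A D : Finset V} {L T : List (V × ℕ)}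
    (h : MoveState G a b W L) (hAW : A ⊆ W) (hDW : Disjoint D W)
    (hDA : ∀ v ∈ D, ∀ y ∈ W, G.Adj v y → y ∈ A) (hT : ∀ e ∈ T, e.1 ∈ A ∪ D)
    (hLT : (L.filter fun e => decide (e.1 ∈ A)) = T.filter fun e => decide (e.1 ∈ A))
    (hmoves : ∀ v ∈ D, Moves (a v) (b v) (own v T))
    (hpair : ∀ v ∈ D, ∀ y ∈ A ∪ D, G.Adj v y → pairOK (a v) (a y) (pr v y T)) :
    ∃ L', MoveState G a b (D ∪ W) L' := by
  have hAD : ∀ x ∈ A, x ∉ D := fun x hx hD => Finset.disjoint_left.1 hDW hD (hAW hx)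
  obtain ⟨L', h1, h2⟩ := exists_merge (fun e : V × ℕ => decide (e.1 ∈ A))
    (fun e => decide (e.1 ∈ D)) L T
    (fun e he => by simpa using Finset.disjoint_right.1 hDW (h.mem e he))
    (fun e he => by simpa using hT e he)
    (by
      rw [hLT]
      refine List.filter_congr fun e he => ?_
      have h3 := Finset.mem_union.1 (hT e he)
      have h4 := hAD e.1
      by_cases hA : e.1 ∈ A <;> by_cases hD : e.1 ∈ D <;> simp_all)
  have hnotD : ∀ u ∈ W, (!decide (u ∈ D)) = true := fun u hu => by
    simpa using Finset.disjoint_right.1 hDW hu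
  have hp : ∀ u ∈ A ∪ D, (decide (u ∈ A) || decide (u ∈ D)) = true := by
    intro u hu; simpa using hu
  have key : ∀ v ∈ D, ∀ y ∈ D ∪ W, G.Adj v y → pairOK (a v) (a y) (pr v y L') := by
    intro v hv y hy hvy
    have hy' : y ∈ A ∪ D := by
      rcases Finset.mem_union.1 hy with hy | hy
      · exact Finset.mem_union_right _ hy
      · exact Finset.mem_union_left _ (hDA v hv y hy hvy)
    rw [← pr_filter (p := fun x => decide (x ∈ A) || decide (x ∈ D))
      (hp v (Finset.mem_union_right _ hv)) (hp y hy'), h2]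
    exact hpair v hv y hy' hvy
  refine ⟨L', ?_, ?_, ?_⟩
  · intro e he
    by_cases hD : e.1 ∈ D
    · exact Finset.mem_union_left _ hD
    · refine Finset.mem_union_right _ (h.mem e ?_)
      rw [← h1]
      simp [he, hD]
  · intro v hv
    rcases Finset.mem_union.1 hv with hv | hv
    · rw [← own_filter (p := fun x => decide (x ∈ A) || decide (x ∈ D))
        (hp v (Finset.mem_union_right _ hv)), h2]
      exact hmoves v hv
    · rw [← own_filter (p := fun x => !decide (x ∈ D)) (hnotD v hv), h1]
      exact h.moves v hv
  · intro u hu w hw huw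
    rcases Finset.mem_union.1 hu with hu' | hu'
    · exact key u hu' w hw huw
    · rcases Finset.mem_union.1 hw with hw' | hw'
      · have := key w hw' u hu huw.symm
        rwa [pr_swap huw.ne, pairOK_flip] at this
      · rw [← pr_filter (p := fun x => !decide (x ∈ D)) (hnotD u hu') (hnotD w hw'), h1]
        exact h.pair u hu' w hw' huw

end Final

section Final
variable {V : Type} [DecidableEq V]

lemma exists_relabel [Nonempty V] {a : V → ℕ} {X : Finset V} (ha : Set.InjOn a X)
    {T : List (ℕ × ℕ)} (hT : ∀ e ∈ T, e.1 ∈ X.image a) :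
    ∃ T' : List (V × ℕ), (∀ e ∈ T', e.1 ∈ X) ∧ (∀ y ∈ X, own y T' = own (a y) T) ∧
      ∀ y ∈ X, ∀ z ∈ X, pr y z T' = pr (a y) (a z) T := by
  have hj : ∀ y ∈ X, Function.invFunOn a X (a y) = y := fun y hy => ha.leftInvOn_invFunOn hy
  set j := Function.invFunOn a X
  have hlab : ∀ y ∈ X, ∀ e ∈ T, j e.1 = j (a y) → e.1 = a y := by
    intro y hy e he h
    obtain ⟨z, hz, hze⟩ := Finset.mem_image.1 (hT e he)
    rw [← hze, hj z hz, hj y hy] at h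
    rw [← hze, h]
  refine ⟨T.map (Prod.map j id), ?_, ?_, ?_⟩
  · intro e he
    obtain ⟨e', he', rfl⟩ := List.mem_map.1 he
    obtain ⟨z, hz, hze⟩ := Finset.mem_image.1 (hT e' he')
    simpa [← hze, hj z hz] using hz
  · intro y hy
    have := own_map (σ := id) (hlab y hy)
    rwa [hj y hy, List.map_id] at this
  · intro y hy z hz
    have := pr_map (σ := id) (hlab y hy) (hlab z hz)
    rwa [hj y hy, hj z hz, Prod.map_id, List.map_id] at this

lemma filter_mem_singleton {L T : List (V × ℕ)} {u : V} (h : own u T = own u L) :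
    (L.filter fun e => decide (e.1 ∈ ({u} : Finset V))) =
      T.filter fun e => decide (e.1 ∈ ({u} : Finset V)) := by
  simp only [Finset.mem_singleton]
  rw [filter_eq_own, filter_eq_own, h]

theorem TriangleTree.exists_moveState {G : SimpleGraph V} {a b : V → ℕ}
    (ha : ∀ u w, G.Adj u w → a u ≠ a w) (hb : ∀ u w, G.Adj u w → b u ≠ b w)
    (ha4 : ∀ v, a v < 4) (hb4 : ∀ v, b v < 4) {W : Finset V} (hW : TriangleTree G W) :
    ∃ L, MoveState G a b W L := by
  induction hW with
  | empty => exact ⟨[], by constructor <;> simp⟩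
  | @add W v u hW hv hN ih =>
    have : Nonempty V := ⟨v⟩
    obtain ⟨L, h⟩ := ih
    rw [Finset.insert_eq]
    by_cases hu : u ∈ W ∧ G.Adj v u
    · obtain ⟨hu, hvu⟩ := hu
      obtain ⟨T, hT, hTu, hTv, hTp⟩ := exists_extend_pendant (h.moves u hu) (ha4 u) (ha4 v)
        (ha v u hvu) (hb4 v) (hb v u hvu)
      have hinj : Set.InjOn a (({u} ∪ {v} : Finset V)) := by
        intro x hx y hy hxy
        simp at hx hy
        rcases hx with rfl | rfl <;> rcases hy with rfl | rfl <;>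
          first | rfl | exact absurd hxy (ha _ _ hvu) | exact absurd hxy.symm (ha _ _ hvu)
      obtain ⟨T', hT', hown, hpr⟩ := exists_relabel hinj (T := T) (by
        intro e he
        rcases hT e he with h | h <;> rw [h] <;> exact Finset.mem_image_of_mem _ (by simp))
      refine h.insert (A := {u}) (D := {v}) (T := T') (by simpa using hu) (by simpa using hv)
        ?_ hT' (filter_mem_singleton ?_) ?_ ?_
      · intro x hx y hy hxy
        rw [Finset.mem_singleton.1 hx] at hxy
        simpa using hN y hy hxy
      · rw [hown u (by simp), hTu]
      · intro x hx
        rw [Finset.mem_singleton.1 hx, hown v (by simp)]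
        exact hTv
      · intro x hx y hy hxy
        rw [Finset.mem_singleton.1 hx] at hxy ⊢
        rw [hpr v (by simp) y hy]
        simp only [Finset.mem_union, Finset.mem_singleton] at hy
        rcases hy with rfl | rfl
        · rwa [pr_swap (ha v y hvu).symm, pairOK_flip]
        · exact absurd rfl hxy.ne
    · have hno : ∀ w ∈ W, ¬ G.Adj v w := by
        intro w hw hvw
        obtain rfl := hN w hw hvw
        exact hu ⟨hw, hvw⟩
      refine h.insert (A := ∅) (D := {v}) (T := if a v = b v then [] else [(v, b v)]) (by simp)
        (by simpa using hv) ?_ ?_ ?_ ?_ ?_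
      · intro x hx y hy hxy
        rw [Finset.mem_singleton.1 hx] at hxy
        exact absurd hxy (hno y hy)
      · split_ifs <;> simp
      · simp
      · intro x hx
        rw [Finset.mem_singleton.1 hx]
        split_ifs with h'
        · exact ⟨by simp, rfl, by simpa using h', by simp⟩
        · refine ⟨?_, ?_, ?_, ?_⟩ <;> simp [own_cons, nt, hb4, Ne.symm h']
      · intro x hx y hy hxy
        simp at hx hy
        subst hx hy
        exact absurd rfl hxy.ne
  | @triangle W v w x hW hv hw hx hvw hvx hwx hNv hNw ih =>
    have : Nonempty V := ⟨v⟩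
    obtain ⟨L, h⟩ := ih
    obtain ⟨T, hT, hTx, hTv, hTw, hxv, hxw, hvw'⟩ := exists_extend_triangle (h.moves x hx) (ha4 x)
      (ha4 v) (ha4 w) (ha v x hvx) (ha w x hwx) (ha v w hvw) (hb4 v) (hb4 w) (hb v x hvx)
      (hb w x hwx) (hb v w hvw)
    have hinj : Set.InjOn a (({x} ∪ {w, v} : Finset V)) := by
      intro y hy z hz hyz
      simp at hy hz
      rcases hy with rfl | rfl | rfl <;> rcases hz with rfl | rfl | rfl <;>
        first
        | rfl
        | exact absurd hyz (ha _ _ ‹_›)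
        | exact absurd hyz.symm (ha _ _ ‹_›)
    obtain ⟨T', hT', hown, hpr⟩ := exists_relabel hinj (T := T) (by
      intro e he
      rcases hT e he with h | h | h <;> rw [h] <;> exact Finset.mem_image_of_mem _ (by simp))
    have hU : insert w (insert v W) = ({w, v} : Finset V) ∪ W := by
      ext y; simp only [Finset.mem_union, Finset.mem_insert, Finset.mem_singleton]; tauto
    rw [hU]
    refine h.insert (A := {x}) (D := {w, v}) (T := T') (by simpa using hx) ?_
      ?_ hT' (filter_mem_singleton ?_) ?_ ?_
    · simp [Finset.disjoint_left, hv, hw]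
    · intro y hy z hz hyz
      simp only [Finset.mem_insert, Finset.mem_singleton] at hy ⊢
      rcases hy with rfl | rfl
      · exact hNw z hz hyz
      · exact hNv z hz hyz
    · rw [hown x (by simp), hTx]
    · intro y hy
      rw [hown y (Finset.mem_union_right _ hy)]
      simp only [Finset.mem_insert, Finset.mem_singleton] at hy
      rcases hy with rfl | rfl
      · exact hTw
      · exact hTv
    · intro y hy z hz hyz
      rw [hpr y (Finset.mem_union_right _ hy) z hz]
      simp only [Finset.mem_union, Finset.mem_insert, Finset.mem_singleton] at hy hz
      rcases hy with rfl | rfl <;> rcases hz with rfl | rfl | rfl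
      · rwa [pr_swap (ha _ _ hwx).symm, pairOK_flip]
      · exact absurd rfl hyz.ne
      · rwa [pr_swap (ha _ _ hvw), pairOK_flip]
      · rwa [pr_swap (ha _ _ hvx).symm, pairOK_flip]
      · exact hvw'
      · exact absurd rfl hyz.ne

end Final

section Reconfiguration
variable {V : Type} [DecidableEq V]

/-- Colorings by natural numbers below `ℓ` which are proper for `G`, up to single recolorings. -/
def reconfGraph {V : Type} (G : SimpleGraph V) (ℓ : ℕ) :
    SimpleGraph {c : V → ℕ // (∀ v, c v < ℓ) ∧ ∀ u w, G.Adj u w → c u ≠ c w} where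
  Adj c d := ∃! v, c.1 v ≠ d.1 v
  symm := ⟨fun c d h => by simpa only [ne_comm] using h⟩
  loopless := ⟨fun c h => by simp [ExistsUnique] at h⟩

/-- The colorings `a` and `b` are joined by a path of length at most `n`. -/
def RecolorJoined {V : Type} (G : SimpleGraph V) (ℓ n : ℕ) (a b : V → ℕ) : Prop :=
  ∃ x y, ∃ p : (reconfGraph G ℓ).Walk x y, x.1 = a ∧ y.1 = b ∧ p.length ≤ n

namespace RecolorJoined
variable {V : Type} {G : SimpleGraph V} {ℓ n k : ℕ} {a b c : V → ℕ}

lemma lt (h : RecolorJoined G ℓ n a b) (v : V) : b v < ℓ := by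
  obtain ⟨x, y, p, rfl, rfl, -⟩ := h
  exact y.2.1 v

lemma ne (h : RecolorJoined G ℓ n a b) (u w : V) : G.Adj u w → b u ≠ b w := by
  obtain ⟨x, y, p, rfl, rfl, -⟩ := h
  exact y.2.2 u w

lemma symm (h : RecolorJoined G ℓ n a b) : RecolorJoined G ℓ n b a := by
  obtain ⟨x, y, p, hx, hy, hp⟩ := h
  exact ⟨y, x, p.reverse, hy, hx, by simpa using hp⟩

lemma trans (h : RecolorJoined G ℓ n a b) (h' : RecolorJoined G ℓ k b c) : RecolorJoined G ℓ (n + k) a c := by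
  obtain ⟨x, y, p, hx, hy, hp⟩ := h
  obtain ⟨z, w, q, hz, hw, hq⟩ := h'
  obtain rfl : y = z := Subtype.ext (hy.trans hz.symm)
  exact ⟨x, w, p.append q, hx, hw, by rw [Walk.length_append]; omega⟩

lemma mono (h : RecolorJoined G ℓ n a b) (hnk : n ≤ k) : RecolorJoined G ℓ k a b := by
  obtain ⟨x, y, p, hx, hy, hp⟩ := h
  exact ⟨x, y, p, hx, hy, hp.trans hnk⟩

lemma exists_isTransformSeq {α β : V → Fin ℓ} (h : RecolorJoined G ℓ n (fun v => α v) (fun v => β v)) :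
    ∃ m ≤ n, ∃ c : Fin (m + 1) → V → Fin ℓ, IsTransformSeq G c α β := by
  obtain ⟨x, y, p, hx, hy, hp⟩ := h
  refine ⟨p.length, hp, fun i v => ⟨(p.getVert i).1 v, (p.getVert i).2.1 v⟩, ?_, ?_, ?_, ?_⟩
  · funext v
    simp [hx]
  · funext v
    simp [hy]
  · intro i u w huw h
    exact (p.getVert i).2.2 u w huw (by simpa using h)
  · intro i
    have h : (reconfGraph G ℓ).Adj (p.getVert i) (p.getVert (i + 1)) := p.adj_getVert_succ i.2
    simpa [Fin.ext_iff] using (show ∃! v, (p.getVert i).1 v ≠ (p.getVert (i + 1)).1 v from h)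

end RecolorJoined

lemma joined_of_pairOK {G : SimpleGraph V} {ℓ : ℕ} (L : List (V × ℕ)) {a : V → ℕ}
    (ha : ∀ v, a v < ℓ) (hL : ∀ e ∈ L, e.2 < ℓ)
    (h : ∀ u w, G.Adj u w → pairOK (a u) (a w) (pr u w L)) :
    RecolorJoined G ℓ L.length a fun v => (own v L).getLastD (a v) := by
  have hprop : ∀ u w, G.Adj u w → a u ≠ a w := fun u w huw => pairOK_ne (h u w huw)
  induction L generalizing a with
  | nil => exact ⟨⟨a, ha, hprop⟩, ⟨a, ha, hprop⟩, .nil, rfl, by simp [own_nil], by simp⟩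
  | cons e L ih =>
    obtain ⟨x, q⟩ := e
    have hq : q < ℓ := hL (x, q) (by simp)
    have ha' : ∀ v, Function.update a x q v < ℓ := by
      intro v
      by_cases hv : v = x
      · simpa [hv] using hq
      · simpa [hv] using ha v
    have h' : ∀ u w, G.Adj u w →
        pairOK (Function.update a x q u) (Function.update a x q w) (pr u w L) := by
      intro u w huw
      have := h u w huw
      rw [pr_cons] at this
      by_cases hu : x = u
      · have hw : w ≠ x := by rintro rfl; exact huw.ne hu.symm
        rw [if_pos hu] at this
        simp only [pairOK, Bool.and_eq_true] at this
        rw [Function.update_of_ne hw, ← hu, Function.update_self, hu]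
        exact this.2.2
      · by_cases hw : x = w
        · rw [if_neg hu, if_pos hw] at this
          simp only [pairOK, Bool.and_eq_true] at this
          rw [Function.update_of_ne (Ne.symm hu), ← hw, Function.update_self, hw]
          exact this.2.2
        · simpa [hu, hw, Ne.symm hu, Ne.symm hw] using this
    have hprop' : ∀ u w, G.Adj u w → Function.update a x q u ≠ Function.update a x q w :=
      fun u w huw => pairOK_ne (h' u w huw)
    have key := ih ha' (fun e he => hL e (by simp [he])) h' hprop'
    have hfin : (fun v => (own v L).getLastD (Function.update a x q v)) =
        fun v => (own v ((x, q) :: L)).getLastD (a v) := by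
      funext v
      rw [own_cons]
      by_cases hv : v = x
      · subst hv
        simp only [Function.update_self, if_true, List.getLastD_cons]
      · rw [if_neg (Ne.symm hv), Function.update_of_ne hv]
    rw [hfin] at key
    by_cases hxq : a x = q
    · rw [← hxq, Function.update_eq_self] at key
      rw [← hxq]
      exact key.mono (by simp)
    · have hstep : RecolorJoined G ℓ 1 a (Function.update a x q) := by
        have hadj : (reconfGraph G ℓ).Adj ⟨a, ha, hprop⟩ ⟨_, ha', hprop'⟩ := by
          refine ⟨x, by simpa using hxq, fun v hv => ?_⟩
          by_contra hvx
          simp [hvx] at hv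
        exact ⟨_, _, hadj.toWalk, rfl, rfl, le_rfl⟩
      exact (hstep.trans key).mono (by simp [add_comm])

lemma length_eq_sum [Fintype V] (L : List (V × ℕ)) : L.length = ∑ v, (own v L).length := by
  induction L with
  | nil => simp [own_nil]
  | cons e L ih =>
    simp only [own_cons]
    have : ∀ v, (if e.1 = v then e.2 :: own v L else own v L).length =
        (own v L).length + if e.1 = v then 1 else 0 := by
      intro v; split_ifs <;> simp
    simp [this, Finset.sum_add_distrib, ih]

lemma length_le_card_mul [Fintype V] {L : List (V × ℕ)} {R : ℕ} (h : ∀ v, (own v L).length ≤ R) :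
    L.length ≤ R * Fintype.card V := by
  rw [length_eq_sum]
  refine (Finset.sum_le_card_nsmul _ _ R fun v _ => h v).trans ?_
  simp [mul_comm]

end Reconfiguration

section Assembly
variable {V : Type} [DecidableEq V]

lemma own_map_const {l : List V} (hl : l.Nodup) (q : ℕ) (v : V) :
    own v (l.map fun x => (x, q)) = if v ∈ l then [q] else [] := by
  induction l with
  | nil => simp
  | cons x l ih =>
    rw [List.nodup_cons] at hl
    rw [List.map_cons, own_cons, ih hl.2]
    by_cases h : x = v
    · subst h; simp [hl.1]
    · simp [h, Ne.symm h]

lemma pr_map_const {l : List V} (hl : l.Nodup) (q : ℕ) {u w : V} (h : ¬ (u ∈ l ∧ w ∈ l)) :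
    pr u w (l.map fun x => (x, q)) =
      if u ∈ l then [(false, q)] else if w ∈ l then [(true, q)] else [] := by
  induction l with
  | nil => simp
  | cons x l ih =>
    rw [List.nodup_cons] at hl
    rw [List.map_cons, pr_cons, ih hl.2 (by simp at h; tauto)]
    by_cases hu : x = u
    · subst hu
      have : w ∉ l := fun hw => h ⟨by simp, by simp [hw]⟩
      simp [hl.1, this]
    · by_cases hw : x = w
      · subst hw
        have : u ∉ l := fun hu => h ⟨by simp [hu], by simp⟩
        simp [hl.1, this, hu, Ne.symm hu]
      · simp [hu, hw, Ne.symm hu, Ne.symm hw]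

/-- Every event of a class representative is carried out by all the members of the class. -/
noncomputable def expand [Fintype V] (rep : V → V) (L : List (V × ℕ)) : List (V × ℕ) :=
  L.flatMap fun e => (Finset.univ.filter fun v => rep v = e.1).toList.map fun v => (v, e.2)

lemma own_expand [Fintype V] (rep : V → V) (L : List (V × ℕ)) (v : V) :
    own v (expand rep L) = own (rep v) L := by
  induction L with
  | nil => rfl
  | cons e L ih =>
    rw [expand, List.flatMap_cons, own_append, own_map_const (Finset.nodup_toList _), ← expand, ih,
      own_cons]
    by_cases h : rep v = e.1
    · simp [h]
    · simp [h, Ne.symm h]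

lemma pr_expand [Fintype V] {rep : V → V} (L : List (V × ℕ)) {u w : V} (huw : rep u ≠ rep w) :
    pr u w (expand rep L) = pr (rep u) (rep w) L := by
  induction L with
  | nil => rfl
  | cons e L ih =>
    rw [expand, List.flatMap_cons, pr_append, pr_map_const (Finset.nodup_toList _), ← expand, ih,
      pr_cons]
    · by_cases hu : rep u = e.1
      · simp [hu]
      · by_cases hw : rep w = e.1
        · simp [hu, hw, Ne.symm hu]
        · simp [hu, hw, Ne.symm hu, Ne.symm hw]
    · simp only [Finset.mem_toList, Finset.mem_filter, Finset.mem_univ, true_and]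
      exact fun h => huw (h.1.trans h.2.symm)

lemma exists_recolorJoined_stage [Fintype V] [Nonempty V] {R t ℓ : ℕ} (hs : StageParams R t)
    {G : SimpleGraph V} (hG : ¬ HasTheta G) (hℓ : 5 ≤ ℓ) {a : V → ℕ} (ha : ∀ v, a v < ℓ)
    (hprop : ∀ u w, G.Adj u w → a u ≠ a w) (ht : t = 4 → ∀ v, a v < 5) :
    ∃ b, (∀ v, b v < t) ∧ RecolorJoined G ℓ (R * Fintype.card V) a b := by
  obtain ⟨rep, L, h⟩ := stageOK_of_theta_free hs G Finset.univ (by simp) hG a ht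
  have hv : ∀ v, vt R t (a v) (own v (expand rep L)) := by
    intro v
    rw [own_expand]
    exact (h.token v (Finset.mem_univ v)).1
  refine ⟨_, fun v => (vt_iff.1 (hv v)).2.1, (joined_of_pairOK (expand rep L) ha ?_ ?_).mono
    (length_le_card_mul fun v => (vt_iff.1 (hv v)).1)⟩
  · intro e he
    exact ((vt_iff.1 (hv e.1)).2.2 e.2 (mem_own.2 he)).trans_le hℓ
  · intro u w huw
    rw [pr_expand]
    · exact h.pair u (by simp) w (by simp) huw (hprop u w huw)
    · intro h'
      apply hprop u w huw
      rw [← (h.rep_mem u (by simp)).2, h', (h.rep_mem w (by simp)).2]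

lemma exists_recolorJoined_lt_four [Fintype V] [Nonempty V] {ℓ : ℕ} {G : SimpleGraph V}
    (hG : ¬ HasTheta G) (hℓ : 5 ≤ ℓ) {a : V → ℕ} (ha : ∀ v, a v < ℓ)
    (hprop : ∀ u w, G.Adj u w → a u ≠ a w) :
    ∃ b, (∀ v, b v < 4) ∧ RecolorJoined G ℓ (3 * Fintype.card V) a b := by
  obtain ⟨b, hb, hab⟩ := exists_recolorJoined_stage (Or.inl ⟨rfl, rfl⟩) hG hℓ ha hprop (by simp)
  obtain ⟨c, hc, hbc⟩ := exists_recolorJoined_stage (Or.inr ⟨rfl, rfl⟩) hG hℓ hab.lt hab.ne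
    fun _ => hb
  exact ⟨c, hc, (hab.trans hbc).mono (by omega)⟩

lemma recolorJoined_independent [Fintype V] {ℓ : ℕ} {G : SimpleGraph V} (hℓ : 5 ≤ ℓ) {a : V → ℕ}
    (ha : ∀ v, a v < 4) (hprop : ∀ u w, G.Adj u w → a u ≠ a w) {I : Finset V}
    (hI : ∀ u ∈ I, ∀ w ∈ I, ¬ G.Adj u w) :
    RecolorJoined G ℓ (Fintype.card V) a fun v => if v ∈ I then 4 else a v := by
  have key := joined_of_pairOK (G := G) (ℓ := ℓ) (a := a) (I.toList.map fun x => (x, 4))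
    (fun v => (ha v).trans (by omega)) ?_ ?_
  · have hfin : (fun v => (own v (I.toList.map fun x => (x, 4))).getLastD (a v)) =
        fun v => if v ∈ I then 4 else a v := by
      funext v
      rw [own_map_const I.nodup_toList]
      by_cases hv : v ∈ I <;> simp [hv]
    rw [hfin] at key
    exact key.mono (by simpa using I.card_le_univ)
  · intro e he
    obtain ⟨x, -, rfl⟩ := List.mem_map.1 he
    exact hℓ
  · intro u w huw
    rw [pr_map_const I.nodup_toList]
    · have h1 := hprop u w huw
      have h2 := (ha u).ne'
      have h3 := (ha w).ne'
      split_ifs <;> simp [pairOK, h1, h2, h3]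
      exact (ha u).ne
    · simp only [Finset.mem_toList]
      exact fun h => hI u h.1 w h.2 huw

lemma pairOK_of_still {a b : ℕ} {E : List (Bool × ℕ)} (hab : a ≠ b) (h : own false E = [])
    (hnt : nt b (own true E)) (hE : ∀ q ∈ own true E, q ≠ a) : pairOK a b E := by
  induction E generalizing b with
  | nil => simpa [pairOK] using hab
  | cons e E ih =>
    obtain ⟨x, q⟩ := e
    cases x
    · simp [own_cons] at h
    · simp only [own_cons, if_true, nt, Bool.and_eq_true, List.mem_cons, forall_eq_or_imp] at hnt hE
      simp only [own_cons, Bool.true_eq_false, if_false] at h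
      simp only [pairOK, Bool.and_eq_true]
      exact ⟨by simpa using hab, hnt.1, ih hE.1.symm h hnt.2 hE.2⟩

lemma recolorJoined_complement [Fintype V] {ℓ : ℕ} {G : SimpleGraph V} (hℓ : 5 ≤ ℓ) {a b : V → ℕ}
    (ha : ∀ v, a v < 4) {I : Finset V}
    (hI : ∀ u ∈ I, ∀ w ∈ I, ¬ G.Adj u w) {L : List (V × ℕ)}
    (h : MoveState G a b (Finset.univ \ I) L) :
    RecolorJoined G ℓ (3 * Fintype.card V) (fun v => if v ∈ I then 4 else a v)
      fun v => if v ∈ I then 4 else b v := by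
  have hmem : ∀ {v}, v ∉ I → v ∈ Finset.univ \ I := by simp
  have hown : ∀ v ∈ I, own v L = [] := by
    intro v hv
    rw [List.eq_nil_iff_forall_not_mem]
    intro q hq
    simpa [hv] using h.mem _ (mem_own.1 hq)
  have hpair : ∀ u ∈ I, ∀ w, G.Adj u w → pairOK 4 (a w) (pr u w L) := by
    intro u hu w huw
    obtain ⟨-, hnt, -, hlt⟩ := h.moves w (hmem fun hw => hI u hu w hw huw)
    apply pairOK_of_still (ha w).ne'
    · rw [own_false_pr, hown u hu]
    · rwa [own_true_pr huw.ne]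
    · rw [own_true_pr huw.ne]
      exact fun q hq => (hlt q hq).ne
  have key := joined_of_pairOK (G := G) (ℓ := ℓ) (a := fun v => if v ∈ I then 4 else a v) L
    ?_ ?_ ?_
  · have hfin : (fun v => (own v L).getLastD (if v ∈ I then 4 else a v)) =
        fun v => if v ∈ I then 4 else b v := by
      funext v
      by_cases hv : v ∈ I
      · simp [hv, hown v hv]
      · simp only [hv, if_false]
        exact (h.moves v (hmem hv)).2.2.1
    rw [hfin] at key
    refine key.mono (length_le_card_mul fun v => ?_)
    by_cases hv : v ∈ I
    · simp [hown v hv]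
    · exact (h.moves v (hmem hv)).1
  · intro v
    have := ha v
    split_ifs <;> omega
  · intro e he
    have := (h.moves e.1 (h.mem e he)).2.2.2 e.2 (mem_own.2 he)
    omega
  · intro u w huw
    by_cases hu : u ∈ I
    · have hw : w ∉ I := fun hw => hI u hu w hw huw
      simpa only [hu, hw, if_true, if_false] using hpair u hu w huw
    · by_cases hw : w ∈ I
      · simp only [hu, hw, if_true, if_false]
        rw [← pairOK_flip, ← pr_swap huw.ne]
        exact hpair w hw u huw.symm
      · simp only [hu, hw, if_false]
        exact h.pair u (hmem hu) w (hmem hw) huw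

lemma recolorJoined_of_lt_four [Fintype V] {ℓ : ℕ} {G : SimpleGraph V} (hG : ¬ HasTheta G)
    (hℓ : 5 ≤ ℓ) {a b : V → ℕ} (ha : ∀ v, a v < 4) (hb : ∀ v, b v < 4)
    (hap : ∀ u w, G.Adj u w → a u ≠ a w) (hbp : ∀ u w, G.Adj u w → b u ≠ b w) :
    RecolorJoined G ℓ (5 * Fintype.card V) a b := by
  obtain ⟨I, -, hI, hT⟩ := exists_independent_triangleTree G Finset.univ (by simp) hG
  obtain ⟨L, hL⟩ := hT.exists_moveState hap hbp ha hb
  exact ((recolorJoined_independent hℓ ha hap hI).trans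
    ((recolorJoined_complement hℓ ha hI hL).trans
      (recolorJoined_independent hℓ hb hbp hI).symm)).mono (by omega)

end Assembly

theorem k23_minor_free_reconf_linear_diameter
    {V : Type} [Fintype V] (G : SimpleGraph V)
    (hG : ¬ IsMinor (completeBipartiteGraph (Fin 2) (Fin 3)) G)
    (ℓ : ℕ) (hℓ : 5 ≤ ℓ) (α β : V → Fin ℓ)
    (hα : IsProperColoring G α) (hβ : IsProperColoring G β) :
    ∃ m : ℕ, m ≤ 1387 * Fintype.card V ∧
      ∃ c : Fin (m + 1) → V → Fin ℓ, IsTransformSeq G c α β := by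
  classical
  rcases isEmpty_or_nonempty V with hV | hV
  · refine ⟨0, Nat.zero_le _, fun _ => α, rfl, Subsingleton.elim _ _, fun _ => hα, fun i => i.elim0⟩
  have hT : ¬ HasTheta G := fun h => hG h.isMinor
  obtain ⟨a, ha, hαa⟩ := exists_recolorJoined_lt_four hT hℓ (a := fun v => (α v : ℕ))
    (fun v => (α v).2) fun u w huw h => hα huw (Fin.ext h)
  obtain ⟨b, hb, hβb⟩ := exists_recolorJoined_lt_four hT hℓ (a := fun v => (β v : ℕ))
    (fun v => (β v).2) fun u w huw h => hβ huw (Fin.ext h)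
  exact ((hαa.trans ((recolorJoined_of_lt_four hT hℓ ha hb hαa.ne hβb.ne).trans hβb.symm)).mono
    (by omega)).exists_isTransformSeq
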